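/- arXiv:2001.07094 — 6 statements merged into one kernel-verified Lean document; each statement's English description precedes it below -/
import Mathlib

section
/- Let p and q be distinct prime numbers with p ≡ 3 (mod 4) and q ≡ 3 (mod 4), let n, m, t ≥ 1 be integers with m ≠ t, and set f = Φ_{pⁿ·qᵐ}·Φ_{pⁿ·qᵗ} ∈ ℤ[X] and N = deg f. If the Legendre symbol (p/q) equals −1, then there do NOT exist matrices B, T ∈ M_N(ℤ) such that: B is symmetric, every diagonal entry of B is even, xᵀ·B·x > 0 for every nonzero x ∈ ℤ^N, det B = 1, Tᵀ·B·T = B, and the characteristic polynomial of T equals f. -/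
open Polynomial Matrix

section GaussSum

open Complex Filter Topology HurwitzZeta

lemma real_mul_cpow {r : ℝ} (hr : 0 < r) {z : ℂ} (hz : z ≠ 0) (s : ℂ) :
    ((r : ℂ) * z) ^ s = (r : ℂ) ^ s * z ^ s := by
  have hr0 : (r : ℂ) ≠ 0 := by exact_mod_cast hr.ne'
  rw [cpow_def_of_ne_zero (mul_ne_zero hr0 hz), cpow_def_of_ne_zero hr0, cpow_def_of_ne_zero hz,
    log_ofReal_mul hr hz, ← Complex.exp_add, add_mul, ofReal_log hr.le]

lemma tendsto_cosKernel_atTop (a : UnitAddCircle) : Tendsto (cosKernel a) atTop (𝓝 1) := by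
  obtain ⟨c, hc, h⟩ := isBigO_atTop_cosKernel_sub a
  have h0 : Tendsto (fun x : ℝ ↦ Real.exp (-c * x)) atTop (𝓝 0) :=
    Real.tendsto_exp_atBot.comp (tendsto_id.const_mul_atTop_of_neg (neg_lt_zero.mpr hc))
  simpa using (h.trans_tendsto h0).add_const 1

lemma tendsto_jacobiTheta_add_mul_I (x : ℝ) :
    Tendsto (fun y : ℝ ↦ jacobiTheta (x + y * I)) atTop (𝓝 1) := by
  have h0 : Tendsto (fun τ : ℂ ↦ Real.exp (-Real.pi * τ.im)) (comap im atTop) (𝓝 0) :=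
    Real.tendsto_exp_atBot.comp
      (tendsto_comap.const_mul_atTop_of_neg (neg_lt_zero.mpr Real.pi_pos))
  have h1 := (isBigO_at_im_infty_jacobiTheta_sub_one.trans_tendsto h0).add_const 1
  simp only [sub_add_cancel, zero_add] at h1
  refine h1.comp (tendsto_comap_iff.mpr ?_)
  have : im ∘ (fun y : ℝ ↦ (x + y * I : ℂ)) = id := by ext; simp
  simpa only [this] using tendsto_id

lemma jacobiTheta_add_nat_of_even {d : ℕ} (hd : Even d) (τ : ℂ) :
    jacobiTheta (τ + d) = jacobiTheta τ := by
  obtain ⟨a, rfl⟩ := hd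
  induction a with
  | zero => simp
  | succ a ih =>
    rw [← ih, ← jacobiTheta_two_add (τ + (a + a : ℕ))]
    congr 1
    push_cast
    ring

/-- The value of the theta function near the cusp `1 / d`, as a quadratic Gauss sum of kernels. -/
lemma jacobiTheta_inv_add {d : ℕ} [NeZero d] (hd : Even d) {y : ℝ} (hy : 0 < y) :
    jacobiTheta (1 / d + I * (1 / (d ^ 2 * y) : ℝ)) =
      (y ^ (1 / 2 : ℝ) : ℝ) * ∑ k : Fin d, cexp (Real.pi * I * (k : ℕ) ^ 2 / d) *
        (cosKernel ((k : ℕ) / d : ℝ) y : ℝ) := by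
  have hd0 : (d : ℂ) ≠ 0 := NeZero.ne _
  have hdR : (0 : ℝ) < d := Nat.cast_pos.mpr (NeZero.pos d)
  set τ : ℂ := 1 / d + I * (1 / (d ^ 2 * y) : ℝ) with hτ
  have him : 0 < τ.im := by
    have : τ.im = 1 / (d ^ 2 * y) := by
      rw [hτ, show (1 / d : ℂ) = ((1 / d : ℝ) : ℂ) by push_cast; rfl, add_im, ofReal_im,
        I_mul_im, ofReal_re, zero_add]
    rw [this]; positivity
  have hsum := hasSum_jacobiTheta₂_term 0 him
  rw [← jacobiTheta_eq_jacobiTheta₂, ← (Int.divModEquiv d).symm.hasSum_iff,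
    ← (Equiv.prodComm (Fin d) ℤ).hasSum_iff] at hsum
  have hk (k : Fin d) : HasSum (fun m : ℤ ↦ cexp (Real.pi * I * (k : ℕ) ^ 2 / d) *
      (Real.exp (-Real.pi * (m + (k : ℕ) / d) ^ 2 * (1 / y)) : ℝ))
      (cexp (Real.pi * I * (k : ℕ) ^ 2 / d) * (evenKernel ((k : ℕ) / d : ℝ) (1 / y) : ℝ)) :=
    (hasSum_ofReal.mpr (hasSum_int_evenKernel _ (by positivity))).mul_left _
  have := hsum.prod_fiberwise (g := fun k : Fin d ↦ cexp (Real.pi * I * (k : ℕ) ^ 2 / d) *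
      (evenKernel ((k : ℕ) / d : ℝ) (1 / y) : ℝ)) (fun k ↦ ?_)
  · rw [this.unique (hasSum_fintype _), Finset.mul_sum]
    refine Finset.sum_congr rfl fun k _ ↦ ?_
    rw [evenKernel_functional_equation, one_div_one_div, Real.div_rpow zero_le_one hy.le,
      Real.one_rpow, one_div_one_div]
    push_cast
    ring
  · convert hk k using 2 with m
    obtain ⟨a, rfl⟩ := hd
    have hy0 : (y : ℂ) ≠ 0 := by exact_mod_cast hy.ne'
    simp only [jacobiTheta₂_term, Function.comp_apply, Equiv.prodComm_apply, Prod.swap_prod_mk,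
      Int.divModEquiv_symm_apply, ofReal_exp, ← Complex.exp_add]
    rw [Complex.exp_eq_exp_iff_exists_int]
    refine ⟨m * (a * m) + m * k, ?_⟩
    rw [hτ]
    have ha0 : (a : ℂ) ≠ 0 := fun h ↦ hd0 (by simp [h])
    push_cast
    rw [← two_mul]
    field_simp
    ring_nf
    simp only [I_sq]
    ring

/-- The quadratic Gauss sum of even modulus has argument `π / 4`. -/
lemma exists_gaussSum_eq {d : ℕ} [NeZero d] (hd : Even d) :
    ∃ r : ℝ, 0 < r ∧
      ∑ k : Fin d, cexp (Real.pi * I * (k : ℕ) ^ 2 / d) = r * cexp (Real.pi * I / 4) := by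
  have hd0 : (d : ℂ) ≠ 0 := NeZero.ne _
  have hdR : (0 : ℝ) < d := Nat.cast_pos.mpr (NeZero.pos d)
  have hfun (τ : ℂ) : (-I * τ) ^ (1 / 2 : ℂ) ≠ 0 →
      (-I * τ) ^ (1 / 2 : ℂ) * jacobiTheta τ = jacobiTheta (-1 / τ) := fun h ↦ by
    have := jacobiTheta₂_functional_equation 0 τ
    simp only [jacobiTheta_eq_jacobiTheta₂]
    rw [this]
    simp only [ne_eq, OfNat.ofNat_ne_zero, not_false_eq_true, zero_pow, mul_zero, zero_div,
      Complex.exp_zero, mul_one]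
    rw [← mul_assoc, mul_one_div_cancel h, one_mul]
  have key : ∀ y : ℝ, 0 < y →
      (d * y / (I + d * y)) ^ (1 / 2 : ℂ) * ((-I * (1 / d + I * (1 / (d ^ 2 * y) : ℝ))) ^ (1 / 2 : ℂ)
        * ∑ k : Fin d, cexp (Real.pi * I * (k : ℕ) ^ 2 / d) *
        (cosKernel ((k : ℕ) / d : ℝ) y : ℝ)) = jacobiTheta ((-1 / d : ℝ) + y * I) := by
    intro y hy
    have hy0 : (y : ℂ) ≠ 0 := by exact_mod_cast hy.ne'
    have hden : I + d * y ≠ 0 := fun h ↦ by simpa using congrArg im h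
    set τ : ℂ := 1 / d + I * (1 / (d ^ 2 * y) : ℝ) with hτ
    have hτ1 : τ = (I + d * y) / (d ^ 2 * y) := by
      rw [hτ]; push_cast; field_simp; ring
    have hτ0 : τ ≠ 0 := by rw [hτ1]; positivity
    set w : ℂ := d * I / (I + d * y) with hw
    have hw0 : w ≠ 0 := by rw [hw]; simp [hd0, hden]
    have h1 := hfun τ (by simp [Complex.cpow_eq_zero_iff, hτ0])
    have h2 := hfun w (by simp [Complex.cpow_eq_zero_iff, hw0])
    have e1 : w = -1 / τ + d := by
      rw [hτ1, hw]; field_simp; ring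
    have e2 : -1 / w = (-1 / d : ℝ) + y * I := by
      rw [hw]; push_cast; field_simp; ring_nf; simp only [I_sq]; ring
    have e3 : -1 / τ = w - d := by rw [e1]; ring
    rw [← e2, ← h2, e1, jacobiTheta_add_nat_of_even hd, ← h1, hτ, jacobiTheta_inv_add hd hy, ← hτ,
      ← e1]
    have e4 : (d * y / (I + d * y)) ^ (1 / 2 : ℂ) =
        (-I * w) ^ (1 / 2 : ℂ) * (y ^ (1 / 2 : ℝ) : ℝ) := by
      have : d * y / (I + d * y) = (y : ℂ) * (-I * w) := by
        rw [hw]; field_simp; simp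
      rw [this, real_mul_cpow hy (by simpa using hw0), Complex.ofReal_cpow hy.le]
      push_cast
      ring
    rw [e4]
    ring
  have hlim1 : Tendsto (fun y : ℝ ↦ ((d * y / (I + d * y)) ^ (1 / 2 : ℂ) : ℂ)) atTop (𝓝 1) := by
    have h0 : Tendsto (fun y : ℝ ↦ 1 + I / d * ((y⁻¹ : ℝ) : ℂ)) atTop (𝓝 1) := by
      simpa using ((continuous_ofReal.tendsto 0 |>.comp tendsto_inv_atTop_zero).const_mul
        (I / d)).const_add 1
    have h1 : Tendsto (fun y : ℝ ↦ (d * y / (I + d * y) : ℂ)) atTop (𝓝 1) := by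
      refine inv_one (G := ℂ) ▸ (h0.inv₀ one_ne_zero).congr' ?_
      filter_upwards [eventually_gt_atTop 0] with y hy
      have hy0 : (y : ℂ) ≠ 0 := by exact_mod_cast hy.ne'
      have hden : I + d * y ≠ 0 := fun h ↦ by simpa using congrArg im h
      have hden' : d * y + I ≠ 0 := by rwa [add_comm]
      push_cast
      field_simp
      rw [add_comm]
    simpa using h1.cpow (tendsto_const_nhds (x := (1 / 2 : ℂ))) (by simp)
  have hlim2 : Tendsto (fun y : ℝ ↦ ((-I * (1 / d + I * (1 / (d ^ 2 * y) : ℝ))) ^ (1 / 2 : ℂ) : ℂ))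
      atTop (𝓝 ((-I / d) ^ (1 / 2 : ℂ))) := by
    refine Tendsto.cpow ?_ tendsto_const_nhds (by simp [mem_slitPlane_iff, hdR.ne'])
    have h0 : Tendsto (fun y : ℝ ↦ ((1 / (d ^ 2 * y) : ℝ) : ℂ)) atTop (𝓝 0) := by
      refine (continuous_ofReal.tendsto 0).comp ?_
      simp only [one_div]
      exact tendsto_inv_atTop_zero.comp (tendsto_id.const_mul_atTop (by positivity))
    convert ((h0.const_mul I).const_add (1 / d : ℂ)).const_mul (-I) using 2
    ring
  have hlim3 : Tendsto (fun y : ℝ ↦ ∑ k : Fin d, cexp (Real.pi * I * (k : ℕ) ^ 2 / d) *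
        (cosKernel ((k : ℕ) / d : ℝ) y : ℝ)) atTop
      (𝓝 (∑ k : Fin d, cexp (Real.pi * I * (k : ℕ) ^ 2 / d))) := by
    refine tendsto_finsetSum _ fun k _ ↦ ?_
    simpa using (continuous_ofReal.tendsto 1 |>.comp
      (tendsto_cosKernel_atTop ((k : ℕ) / d : ℝ))).const_mul (cexp (Real.pi * I * (k : ℕ) ^ 2 / d))
  have hl := (hlim1.mul (hlim2.mul hlim3)).congr' (eventually_gt_atTop 0 |>.mono key)
  have heq := tendsto_nhds_unique hl (tendsto_jacobiTheta_add_mul_I _)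
  refine ⟨(d : ℝ) ^ (1 / 2 : ℝ), by positivity, ?_⟩
  rw [one_mul, show -I / d = ((1 / d : ℝ) : ℂ) * -I by push_cast; ring,
    real_mul_cpow (by positivity) (by simp), cpow_def_of_ne_zero (x := -I) (by simp),
    log_neg_I] at heq
  set g := ∑ k : Fin d, cexp (Real.pi * I * (k : ℕ) ^ 2 / d)
  have e1 : ((d : ℝ) ^ (1 / 2 : ℝ) : ℝ) * ((1 / d : ℝ) : ℂ) ^ (1 / 2 : ℂ) = 1 := by
    rw [show (1 / 2 : ℂ) = ((1 / 2 : ℝ) : ℂ) by push_cast; rfl, ← ofReal_cpow (by positivity),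
      ← ofReal_mul, ← Real.mul_rpow (by positivity) (by positivity), mul_one_div_cancel hdR.ne',
      Real.one_rpow, ofReal_one]
  have e2 : cexp (Real.pi * I / 4) * cexp (-(Real.pi / 2) * I * (1 / 2)) = 1 := by
    rw [← Complex.exp_add, Complex.exp_eq_one_iff]
    exact ⟨0, by push_cast; ring⟩
  calc g = ((d : ℝ) ^ (1 / 2 : ℝ) : ℝ) * ((1 / d : ℝ) : ℂ) ^ (1 / 2 : ℂ) *
        (cexp (Real.pi * I / 4) * cexp (-(Real.pi / 2) * I * (1 / 2))) * g := by
        rw [e1, e2, one_mul, one_mul]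
    _ = ((d : ℝ) ^ (1 / 2 : ℝ) : ℝ) * cexp (Real.pi * I / 4) *
        (((1 / d : ℝ) : ℂ) ^ (1 / 2 : ℂ) * cexp (-(Real.pi / 2) * I * (1 / 2)) * g) := by ring
    _ = _ := by rw [heq, mul_one]

end GaussSum

/-- A subgroup `L` of a rational quadratic space is self-dual, even and of full rank: this encodes
an even unimodular lattice. -/
structure IsEvenUnimodular {V : Type*} [AddCommGroup V] [Module ℚ V]
    (b : LinearMap.BilinForm ℚ V) (L : AddSubgroup V) : Prop where
  mem_iff : ∀ v, v ∈ L ↔ ∀ l ∈ L, ∃ z : ℤ, b v l = z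
  even : ∀ v ∈ L, ∃ z : ℤ, b v v = 2 * z
  full : ∀ v, ∃ c : ℤ, c ≠ 0 ∧ c • v ∈ L

section Rank

variable {V : Type*} [AddCommGroup V] [Module ℚ V] {b : LinearMap.BilinForm ℚ V}
  {L : AddSubgroup V}

/-- The character `x ↦ exp (π i x)` of the additive group of rationals. -/
noncomputable def expPi (x : ℚ) : ℂ := Complex.exp (Real.pi * Complex.I * x)

lemma expPi_add (x y : ℚ) : expPi (x + y) = expPi x * expPi y := by
  simp only [expPi, ← Complex.exp_add]; push_cast; ring_nf

lemma expPi_eq_one_iff (x : ℚ) : expPi x = 1 ↔ ∃ z : ℤ, x = 2 * z := by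
  rw [expPi, Complex.exp_eq_one_iff]
  have h : (Real.pi : ℂ) * Complex.I ≠ 0 := by simp [Real.pi_ne_zero]
  refine exists_congr fun z ↦ ⟨fun hz ↦ ?_, fun hz ↦ ?_⟩
  · have : (x : ℂ) = 2 * z := mul_left_cancel₀ h (by rw [hz]; ring)
    exact_mod_cast this
  · rw [hz]; push_cast; ring

/-- An even unimodular positive definite space has an orthogonal basis of lattice vectors, of even
positive norms. -/
lemma IsEvenUnimodular.exists_basis [FiniteDimensional ℚ V] (hL : IsEvenUnimodular b L)
    (hsymm : LinearMap.IsSymm b) (hpos : ∀ v, v ≠ 0 → 0 < b v v) :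
    ∃ (e : Module.Basis (Fin (Module.finrank ℚ V)) ℚ V) (d : Fin (Module.finrank ℚ V) → ℕ),
      (∀ i j, i ≠ j → b (e i) (e j) = 0) ∧ (∀ i, e i ∈ L) ∧ (∀ i, Even (d i)) ∧
      (∀ i, 0 < d i) ∧ ∀ i, b (e i) (e i) = d i := by
  obtain ⟨e₀, he₀⟩ := LinearMap.BilinForm.exists_orthogonal_basis hsymm
  choose c hc hcL using fun i ↦ hL.full (e₀ i)
  have hu (i) : IsUnit (c i : ℚ) := by simp [hc i]
  set e := e₀.isUnitSMul hu with he
  have heL (i) : e i ∈ L := by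
    rw [he, Module.Basis.isUnitSMul_apply, Int.cast_smul_eq_zsmul]; exact hcL i
  choose z hz using fun i ↦ hL.even (e i) (heL i)
  have hzpos (i) : 0 < z i := by
    have := hpos _ (e.ne_zero i)
    rw [hz] at this
    exact_mod_cast (by linarith : (0 : ℚ) < z i)
  refine ⟨e, fun i ↦ 2 * (z i).toNat, fun i j hij ↦ ?_, heL, fun i ↦ even_two_mul _,
    fun i ↦ by have := hzpos i; dsimp only; omega, fun i ↦ ?_⟩
  · have := he₀ hij
    simp only [Function.onFun] at this
    simp [he, Module.Basis.isUnitSMul_apply, this]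
  · rw [hz]
    have : ((z i).toNat : ℤ) = z i := Int.toNat_of_nonneg (hzpos i).le
    rw [Nat.cast_mul, ← Int.cast_natCast (z i).toNat, this, Nat.cast_ofNat]

/-- If `φ` is quadratic with respect to a subgroup that is isotropic and equal to its own
orthogonal, then the sum of the values of `φ` is the order of the subgroup. -/
lemma sum_eq_card_of_isLagrangian {G : Type*} [AddCommGroup G] [Fintype G] (H : AddSubgroup G)
    [Fintype H] (φ : G → ℂ) (χ : G → AddChar H ℂ) (hφ : ∀ k (h : H), φ (k + h) = φ k * χ k h)
    (hχ : ∀ k, χ k = 0 ↔ k ∈ H) (hφH : ∀ k ∈ H, φ k = 1) : ∑ k, φ k = Fintype.card H := by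
  classical
  have h1 : (Fintype.card H : ℂ) * ∑ k, φ k = Fintype.card H * Fintype.card H := by
    calc (Fintype.card H : ℂ) * ∑ k, φ k = ∑ h : H, ∑ k, φ (k + h) := by
          have (h : H) : ∑ k, φ (k + h) = ∑ k, φ k := Equiv.sum_comp (Equiv.addRight (h : G)) φ
          simp [this]
      _ = ∑ k, φ k * ∑ h : H, χ k h := by
          rw [Finset.sum_comm]
          simp only [hφ, Finset.mul_sum]
      _ = ∑ k, if k ∈ H then (Fintype.card H : ℂ) else 0 := by
          refine Finset.sum_congr rfl fun k _ ↦ ?_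
          rw [AddChar.sum_eq_ite]
          by_cases hk : k ∈ H
          · simp [hk, (hχ k).mpr hk, hφH k hk]
          · simp [hk, (hχ k).not.mpr hk]
      _ = Fintype.card H * Fintype.card H := by
          rw [← Finset.sum_filter, Finset.sum_const, nsmul_eq_mul]
          congr 2
          exact (Fintype.card_of_subtype _ (by simp)).symm
  exact mul_left_cancel₀ (by exact_mod_cast Fintype.card_ne_zero) h1

lemma sum_zmod_val {D : ℕ} [NeZero D] (f : ℕ → ℂ) : ∑ k : ZMod D, f k.val = ∑ k : Fin D, f k := by
  obtain ⟨a, rfl⟩ := Nat.exists_eq_succ_of_ne_zero (NeZero.ne D)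
  rfl

/-- The Gauss sum of the discriminant form of an orthogonal sublattice of a self-dual even lattice
is a positive integer. -/
lemma IsEvenUnimodular.exists_gaussSum_eq_natCast {ι : Type*} [Fintype ι] [DecidableEq ι]
    (hL : IsEvenUnimodular b L) (hsymm : LinearMap.IsSymm b)
    (e : Module.Basis ι ℚ V) (d : ι → ℕ) [hne : ∀ i, NeZero (d i)]
    (hortho : ∀ i j, i ≠ j → b (e i) (e j) = 0) (heL : ∀ i, e i ∈ L)
    (hd : ∀ i, b (e i) (e i) = d i) :
    ∃ c : ℕ, 0 < c ∧ ∑ k : ∀ i, ZMod (d i), expPi (∑ i, ((k i).val ^ 2 / d i : ℚ)) = c := by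
  classical
  have hdQ (i) : (d i : ℚ) ≠ 0 := NeZero.ne _
  -- the representative of a class of the dual of the lattice spanned by `e`
  let v (k : ∀ i, ZMod (d i)) : V := ∑ i, ((k i).val / d i : ℚ) • e i
  have hbe (x : V) (i) : b x (e i) = e.repr x i * d i := by
    conv_lhs => rw [← e.sum_repr x]
    simp only [map_sum, LinearMap.sum_apply, map_smul, LinearMap.smul_apply, smul_eq_mul]
    rw [Finset.sum_eq_single i (fun j _ hj ↦ by rw [hortho _ _ hj, mul_zero]) (by simp), hd]
  have hvrepr (k i) : e.repr (v k) i = (k i).val / d i := by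
    simp only [v, e.repr_sum_self]
  have hbb (x y : V) : b x y = ∑ i, e.repr x i * e.repr y i * d i := by
    conv_lhs => rw [← e.sum_repr y]
    simp only [map_sum, map_smul, smul_eq_mul, hbe]
    exact Finset.sum_congr rfl fun i _ ↦ by ring
  have hmem_of_repr (x : V) (h : ∀ i, ∃ z : ℤ, e.repr x i = z) : x ∈ L := by
    choose z hz using h
    rw [← e.sum_repr x]
    refine sum_mem fun i _ ↦ ?_
    rw [hz, Int.cast_smul_eq_zsmul]
    exact L.zsmul_mem (heL i) _
  have hvL_int (k : ∀ i, ZMod (d i)) (x : V) (hx : ∀ i, ∃ z : ℤ, e.repr x i = z) :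
      ∃ z : ℤ, b (v k) x = z := by
    choose z hz using hx
    refine ⟨∑ i, (k i).val * z i, ?_⟩
    rw [hbb]
    push_cast
    refine Finset.sum_congr rfl fun i _ ↦ ?_
    rw [hvrepr, hz, mul_right_comm, div_mul_cancel₀ _ (hdQ i)]
  have hvadd (k h : ∀ i, ZMod (d i)) (i) : ∃ z : ℤ, e.repr (v (k + h) - (v k + v h)) i = z := by
    refine ⟨-(((k i).val + (h i).val) / d i : ℕ), ?_⟩
    have h1 := Nat.mod_add_div ((k i).val + (h i).val) (d i)
    rw [← ZMod.val_add] at h1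
    have h2 : (((k i + h i).val : ℚ) + d i * (((k i).val + (h i).val) / d i : ℕ)) =
      (k i).val + (h i).val := by exact_mod_cast h1
    simp only [map_sub, map_add, Finsupp.sub_apply, Finsupp.add_apply, hvrepr, Pi.add_apply]
    rw [Int.cast_neg, Int.cast_natCast, div_sub' (hdQ i), div_eq_iff (hdQ i), mul_add,
      mul_div_cancel₀ _ (hdQ i), mul_div_cancel₀ _ (hdQ i)]
    linarith
  -- every lattice vector is some `v k` modulo the span of `e`
  have hsurj (l : V) (hl : l ∈ L) : ∃ k, ∀ i, ∃ z : ℤ, e.repr (l - v k) i = z := by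
    choose z hz using fun i ↦ (hL.mem_iff l).mp hl (e i) (heL i)
    refine ⟨fun i ↦ z i, fun i ↦ ⟨z i / d i, ?_⟩⟩
    have h1 : (((z i : ZMod (d i)).val : ℤ) : ℚ) = (z i % d i : ℤ) := by rw [ZMod.val_intCast]
    have h2 : ((z i % d i : ℤ) : ℚ) + d i * (z i / d i : ℤ) = z i := by
      exact_mod_cast Int.emod_add_mul_ediv (z i) (d i)
    have h3 := hbe l i
    rw [hz] at h3
    push_cast at h1
    rw [map_sub, Finsupp.sub_apply, hvrepr, eq_div_of_mul_eq (hdQ i) h3.symm, h1, ← sub_div,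
      div_eq_iff (hdQ i)]
    linarith
  let H : AddSubgroup (∀ i, ZMod (d i)) :=
    { carrier := {k | v k ∈ L}
      zero_mem' := by simp [v, L.zero_mem]
      add_mem' := fun {k h} hk hh ↦ by
        have := hmem_of_repr _ (hvadd k h)
        simpa using L.add_mem this (L.add_mem hk hh)
      neg_mem' := fun {k} hk ↦ by
        have h1 := hmem_of_repr _ (hvadd k (-k))
        have h0 : v 0 = 0 := by simp [v]
        rw [add_neg_cancel, h0, zero_sub] at h1
        simpa using L.add_mem (L.neg_mem h1) (L.neg_mem hk) }
  have hmemH (k) : k ∈ H ↔ v k ∈ L := Iff.rfl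
  let φ (k : ∀ i, ZMod (d i)) : ℂ := expPi (b (v k) (v k))
  have hφ_def (k) : φ k = expPi (b (v k) (v k)) := rfl
  let χ (k : ∀ i, ZMod (d i)) : AddChar H ℂ :=
    { toFun := fun h ↦ expPi (2 * b (v k) (v h))
      map_zero_eq_one' := by simp [v, expPi]
      map_add_eq_mul' := fun h h' ↦ by
        obtain ⟨z, hz⟩ := hvL_int k _ (hvadd h h')
        have : 2 * b (v k) (v (h + h')) =
            (2 * b (v k) (v h) + 2 * b (v k) (v h')) + 2 * z := by
          rw [← hz]; simp only [map_sub, map_add]; ring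
        push_cast
        rw [this, expPi_add, expPi_add, (expPi_eq_one_iff (2 * z)).mpr ⟨z, rfl⟩, mul_one] }
  have hχ_apply (k) (h : H) : χ k h = expPi (2 * b (v k) (v h)) := rfl
  have hχ (k) : χ k = 0 ↔ k ∈ H := by
    rw [hmemH, hL.mem_iff]
    constructor
    · intro h l hl
      obtain ⟨h', hh'⟩ := hsurj l hl
      obtain ⟨z, hz⟩ := hvL_int k _ hh'
      have hmem : h' ∈ H := by
        rw [hmemH]
        simpa using L.sub_mem hl (hmem_of_repr _ hh')
      have h1 : expPi (2 * b (v k) (v h')) = 1 := by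
        rw [← hχ_apply k ⟨h', hmem⟩, h, AddChar.zero_apply]
      obtain ⟨y, hy⟩ := (expPi_eq_one_iff _).mp h1
      refine ⟨z + y, ?_⟩
      rw [map_sub] at hz
      push_cast
      linarith
    · intro h
      ext ⟨h', hh'⟩
      obtain ⟨z, hz⟩ := h _ hh'
      rw [hχ_apply, AddChar.zero_apply, expPi_eq_one_iff]
      exact ⟨z, by rw [hz]⟩
  have hφ (k) (h : H) : φ (k + h) = φ k * χ k h := by
    obtain ⟨z, hz⟩ := hvL_int k _ (hvadd k h)
    obtain ⟨z', hz'⟩ := hvL_int h _ (hvadd k h)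
    set x := v (k + h) - (v k + v h) with hx
    have hxL := hmem_of_repr _ (hvadd k h)
    obtain ⟨y, hy⟩ := hL.even x hxL
    obtain ⟨y', hy'⟩ := hL.even (v h) h.2
    have : b (v (k + h)) (v (k + h)) = (b (v k) (v k) + 2 * b (v k) (v h)) +
        2 * (z + z' + y + y' : ℤ) := by
      have e1 : v (k + h) = v k + v h + x := by rw [hx]; abel
      rw [e1]
      have s1 := hsymm.eq (v h) (v k)
      have s2 := hsymm.eq x (v k)
      have s3 := hsymm.eq x (v h)
      simp only [RingHom.id_apply] at s1 s2 s3
      simp only [map_add, LinearMap.add_apply]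
      push_cast
      linarith
    rw [hχ_apply, hφ_def, hφ_def, this, expPi_add, expPi_add, (expPi_eq_one_iff _).mpr ⟨_, rfl⟩, mul_one]
  have hφv (k : ∀ i, ZMod (d i)) : expPi (∑ i, ((k i).val ^ 2 / d i : ℚ)) = φ k := by
    rw [hφ_def, hbb]
    congr 1
    refine Finset.sum_congr rfl fun i _ ↦ ?_
    rw [hvrepr]
    field_simp [hdQ i]
  refine ⟨Fintype.card H, Fintype.card_pos, ?_⟩
  simp only [hφv]
  exact sum_eq_card_of_isLagrangian H φ χ hφ hχ fun k hk ↦ (expPi_eq_one_iff _).mpr (hL.even _ hk)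

theorem IsEvenUnimodular.eight_dvd_finrank [FiniteDimensional ℚ V] (hL : IsEvenUnimodular b L)
    (hsymm : LinearMap.IsSymm b) (hpos : ∀ v, v ≠ 0 → 0 < b v v) : 8 ∣ Module.finrank ℚ V := by
  obtain ⟨e, d, hortho, heL, hdeven, hdpos, hd⟩ := hL.exists_basis hsymm hpos
  have hne (i) : NeZero (d i) := ⟨(hdpos i).ne'⟩
  obtain ⟨c, hc, hsum⟩ := hL.exists_gaussSum_eq_natCast hsymm e d hortho heL hd
  generalize Module.finrank ℚ V = N at *
  choose r hr hg using fun i ↦ exists_gaussSum_eq (hdeven i)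
  have hprod : ∑ k : ∀ i, ZMod (d i), expPi (∑ i, ((k i).val ^ 2 / d i : ℚ)) =
       ((∏ i, r i : ℝ) : ℂ) * Complex.exp (Real.pi * Complex.I / 4) ^ N := by
    have h1 (i) : ∑ k : ZMod (d i), Complex.exp (Real.pi * Complex.I * k.val ^ 2 / d i) =
        r i * Complex.exp (Real.pi * Complex.I / 4) := by
      rw [← hg i]
      exact sum_zmod_val fun k ↦ Complex.exp (Real.pi * Complex.I * k ^ 2 / d i)
    calc _ = ∑ k : (∀ i, ZMod (d i)), ∏ i,
          Complex.exp (Real.pi * Complex.I * (k i).val ^ 2 / d i) := by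
          refine Finset.sum_congr rfl fun k _ ↦ ?_
          rw [expPi, ← Complex.exp_sum]
          push_cast
          rw [Finset.mul_sum]
          simp only [mul_div_assoc]
      _ = _ := by
          rw [← Fintype.prod_sum fun i (k : ZMod (d i)) ↦
              Complex.exp (Real.pi * Complex.I * k.val ^ 2 / d i), Finset.prod_congr rfl fun i _ ↦ h1 i, Finset.prod_mul_distrib,
            Finset.prod_const, Finset.card_univ, Fintype.card_fin, Complex.ofReal_prod]
  have hR : (0 : ℝ) < ∏ i, r i := Finset.prod_pos fun i _ ↦ hr i
  rw [hsum, ← Complex.exp_nat_mul] at hprod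
  -- compare arguments
  have hone : Complex.exp (N * (Real.pi * Complex.I / 4)) = 1 := by
    have hnorm := congrArg norm hprod
    have h1 : ‖Complex.exp (N * (Real.pi * Complex.I / 4))‖ = 1 := by
      rw [show (N * (Real.pi * Complex.I / 4) : ℂ) = ((N * Real.pi / 4 : ℝ) : ℂ) * Complex.I by
        push_cast; ring, Complex.norm_exp_ofReal_mul_I]
    rw [norm_mul, h1, mul_one, Complex.norm_natCast, Complex.norm_real,
      Real.norm_of_nonneg hR.le] at hnorm
    rw [← hnorm, Complex.ofReal_natCast] at hprod
    exact (mul_eq_left₀ (by exact_mod_cast hc.ne')).mp hprod.symm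
  obtain ⟨z, hz⟩ := Complex.exp_eq_one_iff.mp hone
  have hN : (N : ℂ) = 8 * z := by
    have h : (Real.pi : ℂ) * Complex.I ≠ 0 := by simp [Real.pi_ne_zero]
    refine mul_left_cancel₀ h ?_
    linear_combination 4 * hz
  have : (N : ℤ) = 8 * z := by exact_mod_cast hN
  omega

end Rank

section Glue

variable {V : Type*} [AddCommGroup V] [Module ℚ V] {b : LinearMap.BilinForm ℚ V}
  {L : AddSubgroup V}

/-- Let `L` be an even unimodular lattice and `W` a subspace such that the dual of `L ∩ W` modulo
`L ∩ W` is killed by an odd number `q`. If a skew-adjoint operator `γ` with `γ ^ 2 = -p` preserves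
`L` and `W`, and `-p` is a unit square modulo `q`, then `W` contains an even unimodular lattice. -/
theorem IsEvenUnimodular.exists_restrict (hL : IsEvenUnimodular b L) (hsymm : LinearMap.IsSymm b)
    {W : Submodule ℚ V} {γ : V →ₗ[ℚ] V} {p q r : ℤ}
    (hγL : ∀ v ∈ L, γ v ∈ L) (hγW : ∀ v ∈ W, γ v ∈ W) (hskew : ∀ x y, b (γ x) y = -b x (γ y))
    (hsq : ∀ x, γ (γ x) = -(p • x)) (hq : Odd q) (hcop : IsCoprime (2 * r) q)
    (hr : q ∣ r ^ 2 + p)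
    (hproj : ∀ l, ∃ v ∈ W, ∀ w ∈ W, b (l - v) w = 0)
    (hkill : ∀ l ∈ L, ∀ v ∈ W, (∀ w ∈ W, b (l - v) w = 0) → q • v ∈ L)
    (hdual : ∀ v ∈ W, (∀ l ∈ L, l ∈ W → ∃ z : ℤ, b v l = z) →
      ∃ l ∈ L, ∀ w ∈ W, b (l - v) w = 0) :
    ∃ L' : AddSubgroup W, IsEvenUnimodular (b.restrict W) L' := by
  have hs (x y) : b x y = b y x := hsymm.eq x y
  let L' : AddSubgroup W :=
    { carrier := {v | (∃ l ∈ L, ∀ w ∈ W, b (l - v) w = 0) ∧ γ v - r • (v : V) ∈ L}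
      zero_mem' := ⟨⟨0, L.zero_mem, by simp⟩, by simp [L.zero_mem]⟩
      add_mem' := by
        rintro x y ⟨⟨l, hl, hlx⟩, hx⟩ ⟨⟨l', hl', hly⟩, hy⟩
        refine ⟨⟨l + l', L.add_mem hl hl', fun w hw ↦ ?_⟩, ?_⟩
        · rw [Submodule.coe_add, add_sub_add_comm, map_add, LinearMap.add_apply, hlx w hw,
            hly w hw, add_zero]
        · rw [Submodule.coe_add, map_add, smul_add, add_sub_add_comm]
          exact L.add_mem hx hy
      neg_mem' := by
        rintro x ⟨⟨l, hl, hlx⟩, hx⟩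
        refine ⟨⟨-l, L.neg_mem hl, fun w hw ↦ ?_⟩, ?_⟩
        · rw [Submodule.coe_neg, ← neg_sub', map_neg, LinearMap.neg_apply, hlx w hw, neg_zero]
        · rw [Submodule.coe_neg, map_neg, smul_neg, ← neg_sub']
          exact L.neg_mem hx }
  have hmem (v : W) : v ∈ L' ↔ (∃ l ∈ L, ∀ w ∈ W, b (l - v) w = 0) ∧ γ v - r • (v : V) ∈ L :=
    Iff.rfl
  have hHW {v : V} (hv : v ∈ W) : γ v - r • v ∈ W := W.sub_mem (hγW _ hv) (zsmul_mem hv _)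
  have hmem_of_mem (v : W) (hv : (v : V) ∈ L) : v ∈ L' :=
    ⟨⟨v, hv, by simp⟩, L.sub_mem (hγL _ hv) (L.zsmul_mem hv _)⟩
  have hint {v : W} (hv : v ∈ L') {x : V} (hxL : x ∈ L) (hxW : x ∈ W) : ∃ z : ℤ, b v x = z := by
    obtain ⟨⟨l, hl, hlv⟩, -⟩ := hv
    obtain ⟨z, hz⟩ := (hL.mem_iff l).mp hl x hxL
    refine ⟨z, ?_⟩
    have := hlv x hxW
    rw [map_sub, LinearMap.sub_apply] at this
    linarith
  have hqmem {v : W} (hv : v ∈ L') : q • (v : V) ∈ L := by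
    obtain ⟨⟨l, hl, hlv⟩, -⟩ := hv
    exact hkill l hl v v.2 hlv
  have hpair {v w : W} (hv : v ∈ L') (hw : w ∈ L') : ∃ z : ℤ, b v w = z := by
    obtain ⟨α, β, hαβ⟩ := hcop
    obtain ⟨z₁, hz₁⟩ := hint hv hw.2 (hHW w.2)
    obtain ⟨z₂, hz₂⟩ := hint hw hv.2 (hHW v.2)
    obtain ⟨z₃, hz₃⟩ := hint hv (hqmem hw) (zsmul_mem w.2 _)
    refine ⟨-α * (z₁ + z₂) + β * z₃, ?_⟩
    have e := hskew v w
    rw [hs (w : V)] at hz₂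
    simp only [map_sub, LinearMap.sub_apply, map_zsmul, LinearMap.smul_apply, zsmul_eq_mul]
      at hz₁ hz₂ hz₃
    have hαβ' : (α * (2 * r) + β * q : ℚ) = 1 := by exact_mod_cast hαβ
    push_cast
    rw [← hz₁, ← hz₂, ← hz₃, e]
    linear_combination (-b v w) * hαβ'
  refine ⟨L', ⟨fun v ↦ ⟨fun hv w hw ↦ hpair hv hw, fun hv ↦ ?_⟩, fun v hv ↦ ?_, fun v ↦ ?_⟩⟩
  · refine (hmem v).mpr ⟨hdual v v.2 fun l hl hlW ↦ hv ⟨l, hlW⟩ (hmem_of_mem _ hl), ?_⟩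
    rw [hL.mem_iff]
    intro l hl
    obtain ⟨u, huW, hu⟩ := hproj l
    have huL : (⟨γ u + r • u, W.add_mem (hγW _ huW) (zsmul_mem huW _)⟩ : W) ∈ L' := by
      refine (hmem _).mpr ⟨⟨γ l + r • l, L.add_mem (hγL _ hl) (L.zsmul_mem hl _), ?_⟩, ?_⟩
      · intro w hw
        have e : γ l + r • l - (γ u + r • u) = γ (l - u) + r • (l - u) := by
          rw [map_sub, smul_sub]; abel
        rw [e, map_add, LinearMap.add_apply, hskew, hu _ (hγW _ hw), map_zsmul,
          LinearMap.smul_apply, hu _ hw]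
        simp
      · obtain ⟨c, hc⟩ := hr
        have e : γ (γ u + r • u) - r • (γ u + r • u) = -(c • q • u) := by
          rw [map_add, map_zsmul, hsq, smul_smul, mul_comm c, ← hc]
          module
        simp only [e]
        exact L.neg_mem (L.zsmul_mem (hkill l hl u huW hu) _)
    obtain ⟨z, hz⟩ := hv _ huL
    refine ⟨-z, ?_⟩
    have e1 := hu _ (hHW v.2)
    have e2 := hskew v u
    have hz' : b (v : V) (γ u + r • u) = z := hz
    rw [hs] at e1
    simp only [map_sub, LinearMap.sub_apply, map_zsmul, LinearMap.smul_apply, zsmul_eq_mul,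
      map_add] at e1 hz' ⊢
    push_cast
    linarith
  · obtain ⟨z, hz⟩ := hpair hv hv
    obtain ⟨y, hy⟩ := hL.even _ (hqmem hv)
    simp only [map_zsmul, LinearMap.smul_apply, zsmul_eq_mul, hz] at hy
    have hy' : q * (q * z) = 2 * y := by exact_mod_cast hy
    have hz2 : Even z := by
      have : Even (q * (q * z)) := hy' ▸ even_two_mul y
      rw [Int.even_mul, Int.even_mul] at this
      have := Int.not_even_iff_odd.mpr hq
      tauto
    obtain ⟨x, rfl⟩ := hz2
    exact ⟨x, by change b v v = _; rw [hz]; push_cast; ring⟩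
  · obtain ⟨c, hc, hcv⟩ := hL.full (v : V)
    exact ⟨c, hc, hmem_of_mem _ hcv⟩

end Glue

section IntLattice

/-- The standard lattice of integral vectors. -/
def intLattice (ι : Type*) : AddSubgroup (ι → ℚ) :=
  ((Int.castAddHom ℚ).compLeft ι).range

lemma mem_intLattice {ι : Type*} {v : ι → ℚ} :
    v ∈ intLattice ι ↔ ∃ z : ι → ℤ, (fun i ↦ (z i : ℚ)) = v :=
  Iff.rfl

lemma intCast_mem_intLattice {ι : Type*} (z : ι → ℤ) : (fun i ↦ (z i : ℚ)) ∈ intLattice ι :=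
  ⟨z, rfl⟩

lemma exists_smul_mem_intLattice {ι : Type*} [Finite ι] (v : ι → ℚ) :
    ∃ c : ℤ, c ≠ 0 ∧ c • v ∈ intLattice ι := by
  obtain ⟨c, hc⟩ := IsLocalization.exist_integer_multiples_of_finite (nonZeroDivisors ℤ) v
  choose z hz using hc
  exact ⟨c, nonZeroDivisors.coe_ne_zero c, z, funext fun i ↦ by simpa using hz i⟩

variable {ι : Type*} [Fintype ι] [DecidableEq ι]

/-- The rational bilinear form with integral Gram matrix `B`. -/
noncomputable def gramForm (B : Matrix ι ι ℤ) : LinearMap.BilinForm ℚ (ι → ℚ) :=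
  Matrix.toLinearMap₂' ℚ (B.map (Int.cast : ℤ → ℚ))

lemma gramForm_apply (B : Matrix ι ι ℤ) (v w : ι → ℚ) :
    gramForm B v w = v ⬝ᵥ B.map (Int.cast : ℤ → ℚ) *ᵥ w := by
  rw [gramForm, Matrix.toLinearMap₂'_apply']

lemma gramForm_intCast (B : Matrix ι ι ℤ) (x y : ι → ℤ) :
    gramForm B (fun i ↦ (x i : ℚ)) (fun i ↦ (y i : ℚ)) = ((x ⬝ᵥ B *ᵥ y : ℤ) : ℚ) := by
  simp [gramForm_apply, dotProduct, mulVec]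

lemma gramForm_isSymm {B : Matrix ι ι ℤ} (hB : B.IsSymm) : LinearMap.IsSymm (gramForm B) := by
  refine ⟨fun v w ↦ ?_⟩
  rw [RingHom.id_apply, gramForm_apply, gramForm_apply, dotProduct_comm, ← vecMul_transpose,
    ← dotProduct_mulVec, ← transpose_map, hB.eq]

lemma gramForm_pos {B : Matrix ι ι ℤ} (hpos : ∀ x, x ≠ 0 → 0 < x ⬝ᵥ B *ᵥ x) (v : ι → ℚ)
    (hv : v ≠ 0) : 0 < gramForm B v v := by
  obtain ⟨c, hc, z, hz⟩ := exists_smul_mem_intLattice v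
  have hcv : c • v ≠ 0 := smul_ne_zero hc hv
  have hz0 : z ≠ 0 := by
    rintro rfl
    exact hcv (by rw [← hz]; simp)
  have h := gramForm_intCast B z z
  rw [show (fun i ↦ (z i : ℚ)) = c • v from hz, map_zsmul, map_zsmul, LinearMap.smul_apply,
    smul_smul, zsmul_eq_mul] at h
  have hc2 : (0 : ℚ) < ((c * c : ℤ) : ℚ) := by exact_mod_cast mul_self_pos.mpr hc
  refine (mul_pos_iff_of_pos_left hc2).mp ?_
  rw [h]
  exact_mod_cast hpos z hz0

/-- A unimodular Gram matrix represents every integral functional. -/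
lemma exists_gramForm_eq {B : Matrix ι ι ℤ} (hdet : B.det = 1) (u : ι → ℤ) :
    ∃ l ∈ intLattice ι, ∀ x, gramForm B l x = (fun i ↦ (u i : ℚ)) ⬝ᵥ x := by
  refine ⟨_, intCast_mem_intLattice (u ᵥ* B⁻¹), fun x ↦ ?_⟩
  rw [gramForm_apply, dotProduct_mulVec]
  congr 1
  have h : u ᵥ* B⁻¹ ᵥ* B = u := by
    rw [vecMul_vecMul, nonsing_inv_mul _ (by simp [hdet]), vecMul_one]
  funext i
  conv_rhs => rw [← h]
  simp [vecMul, dotProduct]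

lemma even_dotProduct_mulVec {B : Matrix ι ι ℤ} (hB : B.IsSymm) (heven : ∀ i, Even (B i i))
    (x : ι → ℤ) : Even (x ⬝ᵥ B *ᵥ x) := by
  rw [← Finset.univ_sum_single x]
  refine Finset.sum_induction _ (fun y : ι → ℤ ↦ Even (y ⬝ᵥ B *ᵥ y)) (fun y z hy hz ↦ ?_)
    (by simp) fun i _ ↦ ?_
  · have h : z ⬝ᵥ B *ᵥ y = y ⬝ᵥ B *ᵥ z := by
      rw [dotProduct_comm, ← vecMul_transpose, ← dotProduct_mulVec, hB.eq]
    rw [mulVec_add, dotProduct_add, add_dotProduct, add_dotProduct, h]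
    obtain ⟨a, ha⟩ := hy
    obtain ⟨c, hc⟩ := hz
    exact ⟨a + c + y ⬝ᵥ B *ᵥ z, by rw [ha, hc]; ring⟩
  · simpa using ((heven i).mul_left (x i)).mul_left (x i)

lemma isEvenUnimodular_intLattice {B : Matrix ι ι ℤ} (hB : B.IsSymm) (heven : ∀ i, Even (B i i))
    (hpos : ∀ x, x ≠ 0 → 0 < x ⬝ᵥ B *ᵥ x) (hdet : B.det = 1) :
    IsEvenUnimodular (gramForm B) (intLattice ι) where
  mem_iff v := by
    constructor
    · rintro ⟨x, rfl⟩ l ⟨y, rfl⟩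
      exact ⟨_, gramForm_intCast B x y⟩
    · intro h
      have hsingle (i : ι) : (Pi.single i 1 : ι → ℚ) ∈ intLattice ι :=
        ⟨Pi.single i 1, funext fun j ↦ by simp [Pi.single_apply]⟩
      choose u hu using fun i ↦ h _ (hsingle i)
      obtain ⟨l, hl, hlu⟩ := exists_gramForm_eq hdet u
      have e : gramForm B v = gramForm B l :=
        LinearMap.pi_ext' fun i ↦ LinearMap.ext_ring (by simp [hu, hlu])
      have : v - l = 0 := by
        by_contra hne
        have := gramForm_pos hpos _ hne
        rw [map_sub (gramForm B), e, sub_self] at this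
        simp at this
      rwa [sub_eq_zero.mp this]
  even v := by
    rintro ⟨x, rfl⟩
    obtain ⟨a, ha⟩ := even_dotProduct_mulVec hB heven x
    refine ⟨a, (gramForm_intCast B x x).trans ?_⟩
    rw [ha]; push_cast; ring
  full := exists_smul_mem_intLattice

/-- The natural map from integral matrices to rational endomorphisms. -/
noncomputable def ratEnd (ι : Type*) [Fintype ι] [DecidableEq ι] :
    Matrix ι ι ℤ →ₐ[ℤ] Module.End ℚ (ι → ℚ) :=
  ((Matrix.toLinAlgEquiv' (R := ℚ) (n := ι)).toAlgHom.toRingHom.comp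
    (Int.castRingHom ℚ).mapMatrix).toIntAlgHom

lemma ratEnd_apply (M : Matrix ι ι ℤ) (v : ι → ℚ) :
    ratEnd ι M v = M.map (Int.cast : ℤ → ℚ) *ᵥ v := rfl

lemma ratEnd_injective : Function.Injective (ratEnd ι) :=
  (Matrix.toLinAlgEquiv' (R := ℚ) (n := ι)).injective.comp
    (Matrix.map_injective (Int.cast_injective (α := ℚ)))

lemma ratEnd_intCast (M : Matrix ι ι ℤ) (x : ι → ℤ) :
    ratEnd ι M (fun i ↦ (x i : ℚ)) = fun i ↦ ((M *ᵥ x) i : ℚ) := by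
  funext i
  simp [ratEnd_apply, mulVec, dotProduct]

lemma ratEnd_mem_intLattice (M : Matrix ι ι ℤ) {v : ι → ℚ} (hv : v ∈ intLattice ι) :
    ratEnd ι M v ∈ intLattice ι := by
  obtain ⟨x, rfl⟩ := mem_intLattice.mp hv
  rw [ratEnd_intCast]
  exact intCast_mem_intLattice _

/-- A functional that is integral on the lattice points of the kernel of an integral matrix is
represented on this kernel by a lattice vector. -/
lemma exists_mem_intLattice_sub_ortho {B : Matrix ι ι ℤ} (hdet : B.det = 1) (M : Matrix ι ι ℤ)
    (v : ι → ℚ) (hv : ∀ l ∈ intLattice ι, l ∈ LinearMap.ker (ratEnd ι M) →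
      ∃ z : ℤ, gramForm B v l = z) :
    ∃ l ∈ intLattice ι, ∀ w ∈ LinearMap.ker (ratEnd ι M), gramForm B (l - v) w = 0 := by
  obtain ⟨s, hs⟩ := Module.projective_lifting_property M.mulVecLin.rangeRestrict
    (LinearMap.id (R := ℤ)) M.mulVecLin.surjective_rangeRestrict
  have hs' (x : ι → ℤ) : M *ᵥ s (M.mulVecLin.rangeRestrict x) = M *ᵥ x :=
    congrArg Subtype.val (LinearMap.congr_fun hs (M.mulVecLin.rangeRestrict x))
  let π : (ι → ℤ) →ₗ[ℤ] (ι → ℤ) := LinearMap.id - s ∘ₗ M.mulVecLin.rangeRestrict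
  have hker (x : ι → ℤ) : M *ᵥ π x = 0 := by
    simp [π, mulVec_sub, hs']
  have hfix (x : ι → ℤ) (hx : M *ᵥ x = 0) : π x = x := by
    have : M.mulVecLin.rangeRestrict x = 0 := Subtype.ext hx
    simp [π, this]
  choose u hu using fun i ↦ hv _ (intCast_mem_intLattice (π (Pi.single i 1)))
    (by rw [LinearMap.mem_ker, ratEnd_intCast, hker]; rfl)
  obtain ⟨l, hl, hlu⟩ := exists_gramForm_eq hdet u
  refine ⟨l, hl, fun w hw ↦ ?_⟩
  obtain ⟨c, hc, x, hx⟩ := exists_smul_mem_intLattice w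
  have hx' : (fun i ↦ (x i : ℚ)) = c • w := hx
  have hMx : M *ᵥ x = 0 := by
    have h := ratEnd_intCast M x
    rw [hx', map_zsmul, LinearMap.mem_ker.mp hw, smul_zero] at h
    funext i
    have hi : (((M *ᵥ x) i : ℤ) : ℚ) = 0 := (congrFun h i).symm
    exact_mod_cast hi
  have hπ : (gramForm B v) (fun i ↦ (π x i : ℚ)) = (fun i ↦ (u i : ℚ)) ⬝ᵥ fun i ↦ (x i : ℚ) := by
    let ρ : (ι → ℤ) →ₗ[ℤ] ℚ := ((gramForm B v).restrictScalars ℤ) ∘ₗ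
      ((Algebra.linearMap ℤ ℚ).compLeft ι) ∘ₗ π
    have h := LinearMap.pi_apply_eq_sum_univ ρ x
    rw [dotProduct]
    refine h.trans (Finset.sum_congr rfl fun i _ ↦ ?_)
    have : ρ (fun j ↦ if i = j then 1 else 0) = u i := by
      rw [← hu, show (Pi.single i 1 : ι → ℤ) = fun j ↦ if i = j then 1 else 0 from
        funext fun j ↦ by simp [Pi.single_apply, eq_comm]]
      rfl
    rw [this, zsmul_eq_mul, mul_comm]
  rw [hfix x hMx, ← hlu, hx', map_zsmul, map_zsmul] at hπ
  rw [map_sub (gramForm B), LinearMap.sub_apply, smul_right_injective ℚ hc hπ, sub_self]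

end IntLattice

section Cyclotomic

lemma cyclotomic_dvd_of_aeval_eq_zero {k : ℕ} (hk : 0 < k) {ζ : ℂ} (hζ : IsPrimitiveRoot ζ k)
    {g : ℤ[X]} (hg : aeval ζ g = 0) : cyclotomic k ℤ ∣ g := by
  rw [cyclotomic_eq_minpoly hζ hk]
  exact minpoly.isIntegrallyClosed_dvd (hζ.isIntegral hk) hg

lemma not_cyclotomic_dvd_cyclotomic {a b : ℕ} (ha : 0 < a) (hb : 0 < b) (hab : a ≠ b) :
    ¬ cyclotomic a ℤ ∣ cyclotomic b ℤ := fun h ↦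
  hab (cyclotomic_injective (R := ℤ) (eq_of_monic_of_associated (cyclotomic.monic a ℤ)
    (cyclotomic.monic b ℤ) ((cyclotomic.irreducible ha).associated_of_dvd
      (cyclotomic.irreducible hb) h)))

lemma cyclotomic_mul_cyclotomic_dvd {a b : ℕ} (ha : 0 < a) (hb : 0 < b) (hab : a ≠ b) {g : ℤ[X]}
    (hga : cyclotomic a ℤ ∣ g) (hgb : cyclotomic b ℤ ∣ g) :
    cyclotomic a ℤ * cyclotomic b ℤ ∣ g :=
  ((cyclotomic.irreducible ha).isRelPrime_iff_not_dvd.mpr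
    (not_cyclotomic_dvd_cyclotomic ha hb hab)).mul_dvd hga hgb

/-- The polynomial whose value at a primitive `p`-th root of unity is the quadratic Gauss sum. -/
noncomputable def gaussPoly (p : ℕ) [Fact p.Prime] : ℤ[X] :=
  ∑ a : ZMod p, C (quadraticChar (ZMod p) a) * X ^ a.val

lemma aeval_gaussPoly_sq {p : ℕ} [Fact p.Prime] (hp : p % 4 = 3) {ω : ℂ}
    (hω : IsPrimitiveRoot ω p) : aeval ω (gaussPoly p) ^ 2 = -p := by
  have hp2 : ringChar (ZMod p) ≠ 2 := by
    rw [ZMod.ringChar_zmod_n]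
    rintro rfl
    omega
  let χ : MulChar (ZMod p) ℂ := (quadraticChar (ZMod p)).ringHomComp (Int.castRingHom ℂ)
  have hχ1 : χ ≠ 1 :=
    (MulChar.ringHomComp_ne_one_iff Int.cast_injective).mpr (quadraticChar_ne_one hp2)
  have hχ2 : χ.IsQuadratic := (quadraticChar_isQuadratic (ZMod p)).comp _
  have hψ := AddChar.zmodChar_primitive_of_primitive_root p hω
  have h := gaussSum_sq hχ1 hχ2 hψ
  have e : gaussSum χ (AddChar.zmodChar p ((IsPrimitiveRoot.iff_def ω p).mp hω).left) =
      aeval ω (gaussPoly p) := by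
    simp [gaussSum, gaussPoly, χ, AddChar.zmodChar_apply]
  have e1 : χ (-1) = -1 := by
    have : quadraticChar (ZMod p) (-1) = -1 := by
      rw [quadraticChar_neg_one hp2, ZMod.card, ZMod.χ₄_nat_three_mod_four hp]
    simp [χ, this]
  rw [← e, h, e1, ZMod.card, neg_one_mul]

lemma cyclotomic_dvd_expand_gaussPoly_sq {p q : ℕ} [Fact p.Prime] (hq : q.Prime) (hpq : p ≠ q)
    (hp4 : p % 4 = 3) {n m M : ℕ} (hn : 1 ≤ n) (hM : m ≤ M) :
    cyclotomic (p ^ n * q ^ m) ℤ ∣ expand ℤ (p ^ (n - 1) * q ^ M) (gaussPoly p) ^ 2 + C (p : ℤ) := by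
  have hp : p.Prime := Fact.out
  have hk : 0 < p ^ n * q ^ m := by have := hp.pos; have := hq.pos; positivity
  have hζ := Complex.isPrimitiveRoot_exp _ hk.ne'
  refine cyclotomic_dvd_of_aeval_eq_zero hk hζ ?_
  generalize Complex.exp (2 * Real.pi * Complex.I / (p ^ n * q ^ m : ℕ)) = ζ at hζ
  have h1 : IsPrimitiveRoot (ζ ^ (p ^ (n - 1) * q ^ m)) p := by
    refine hζ.pow hk ?_
    obtain ⟨n, rfl⟩ := Nat.exists_eq_add_of_le' hn
    rw [Nat.add_sub_cancel]
    ring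
  have h2 := h1.pow_of_coprime (q ^ (M - m))
    (((Nat.coprime_primes hq hp).mpr hpq.symm).pow_left _)
  rw [← pow_mul, mul_assoc, ← pow_add, Nat.add_sub_cancel' hM] at h2
  simp [expand_aeval, aeval_gaussPoly_sq hp4 h2]

lemma cyclotomic_dvd_sum_X_pow {D q : ℕ} (hD : 0 < D) (hq : 1 < q) :
    cyclotomic (D * q) ℤ ∣ ∑ j ∈ Finset.range q, (X ^ D) ^ j := by
  have h := X_pow_sub_one_mul_cyclotomic_dvd_X_pow_sub_one_of_dvd ℤ
    (d := D) (n := D * q) (by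
      rw [Nat.mem_properDivisors]
      exact ⟨dvd_mul_right D q, lt_mul_of_one_lt_right hD hq⟩)
  rw [pow_mul, ← geom_sum_mul (X ^ D : ℤ[X]), mul_comm (X ^ D - 1 : ℤ[X])] at h
  exact (mul_dvd_mul_iff_right (X_pow_sub_C_ne_zero hD (1 : ℤ))).mp (by simpa using h)

lemma not_eight_dvd_totient {p q : ℕ} (hp : p.Prime) (hq : q.Prime) (hpq : p ≠ q)
    (hp4 : p % 4 = 3) (hq4 : q % 4 = 3) {n m : ℕ} (hn : 1 ≤ n) (hm : 1 ≤ m) :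
    ¬ 8 ∣ (p ^ n * q ^ m).totient := by
  rw [Nat.totient_mul (Nat.Coprime.pow _ _ ((Nat.coprime_primes hp hq).mpr hpq)),
    Nat.totient_prime_pow hp hn, Nat.totient_prime_pow hq hm]
  obtain ⟨a, ha⟩ : ∃ a, p - 1 = 2 * (2 * a + 1) := ⟨p / 4, by omega⟩
  obtain ⟨c, hc⟩ : ∃ c, q - 1 = 2 * (2 * c + 1) := ⟨q / 4, by omega⟩
  have ho : Odd (p ^ (n - 1) * (2 * a + 1) * (q ^ (m - 1) * (2 * c + 1))) := by
    have hp' : Odd p := Nat.odd_iff.mpr (by omega)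
    have hq' : Odd q := Nat.odd_iff.mpr (by omega)
    exact ((hp'.pow).mul (odd_two_mul_add_one a)).mul ((hq'.pow).mul (odd_two_mul_add_one c))
  rw [ha, hc, show p ^ (n - 1) * (2 * (2 * a + 1)) * (q ^ (m - 1) * (2 * (2 * c + 1))) =
    4 * (p ^ (n - 1) * (2 * a + 1) * (q ^ (m - 1) * (2 * c + 1))) by ring]
  obtain ⟨k, hk⟩ := ho
  omega

lemma exists_dvd_sq_add {p q : ℕ} [Fact q.Prime] (hq4 : q % 4 = 3) (hleg : legendreSym q p = -1) :
    ∃ r : ℤ, (q : ℤ) ∣ r ^ 2 + p ∧ IsCoprime (2 * r) (q : ℤ) := by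
  have hq : q.Prime := Fact.out
  have hp0 : ((p : ℤ) : ZMod q) ≠ 0 := by
    intro h
    rw [(legendreSym.eq_zero_iff q p).mpr h] at hleg
    norm_num at hleg
  have h : legendreSym q (-p) = 1 := by
    rw [← neg_one_mul, legendreSym.mul, hleg, legendreSym.at_neg_one (by rintro rfl; omega),
      ZMod.χ₄_nat_three_mod_four hq4]
    norm_num
  obtain ⟨x, hx⟩ := (legendreSym.eq_one_iff q (by simpa using hp0)).mp h
  obtain ⟨r, rfl⟩ := ZMod.intCast_surjective x
  have hr : (q : ℤ) ∣ r ^ 2 + p := by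
    rw [← ZMod.intCast_zmod_eq_zero_iff_dvd]
    push_cast at hx ⊢
    rw [pow_two, ← hx, neg_add_cancel]
  refine ⟨r, hr, ((Nat.prime_iff_prime_int.mp hq).irreducible.coprime_iff_not_dvd.mpr
    fun h2 ↦ ?_).symm⟩
  rcases (Nat.prime_iff_prime_int.mp hq).dvd_or_dvd h2 with h3 | h3
  · have := Nat.le_of_dvd two_pos (by exact_mod_cast h3 : q ∣ 2)
    omega
  · refine hp0 ((ZMod.intCast_zmod_eq_zero_iff_dvd _ q).mpr ?_)
    exact (dvd_add_right (dvd_pow h3 two_ne_zero)).mp hr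

end Cyclotomic

section Isometry

variable {V : Type*} [AddCommGroup V] [Module ℚ V] {b : LinearMap.BilinForm ℚ V}
  {f : Module.End ℚ V}

lemma aeval_apply_mem {U : Submodule ℚ V} (hU : ∀ u ∈ U, f u ∈ U) (g : ℤ[X]) {u : V}
    (hu : u ∈ U) : aeval f g u ∈ U := by
  have hpow (k : ℕ) : (f ^ k) u ∈ U := by
    induction k with
    | zero => simpa using hu
    | succ k ih => rw [pow_succ']; exact hU _ ih
  rw [aeval_eq_sum_range, LinearMap.sum_apply]
  exact U.sum_mem fun i _ ↦ zsmul_mem (hpow i) _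

lemma aeval_mul_apply (g h : ℤ[X]) (v : V) : aeval f (g * h) v = aeval f g (aeval f h v) := by
  rw [map_mul, Module.End.mul_apply]

lemma apply_mem_ker_aeval (g : ℤ[X]) {v : V} (hv : v ∈ LinearMap.ker (aeval f g)) (h : ℤ[X]) :
    aeval f h v ∈ LinearMap.ker (aeval f g) := by
  rw [LinearMap.mem_ker] at hv ⊢
  rw [← aeval_mul_apply, mul_comm, aeval_mul_apply, hv, map_zero]

lemma aeval_apply_eq_zero_of_dvd {g h : ℤ[X]} (hgh : g ∣ h) {v : V} (hv : aeval f g v = 0) :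
    aeval f h v = 0 := by
  obtain ⟨k, rfl⟩ := hgh
  rw [mul_comm, aeval_mul_apply, hv, map_zero]

lemma isometry_pow (hf : ∀ x y, b (f x) (f y) = b x y) (k : ℕ) (x y : V) :
    b ((f ^ k) x) ((f ^ k) y) = b x y := by
  induction k with
  | zero => simp
  | succ k ih => rw [pow_succ', Module.End.mul_apply, Module.End.mul_apply, hf, ih]

lemma disjoint_orthogonal (hpos : ∀ v, v ≠ 0 → 0 < b v v) (W : Submodule ℚ V) :
    Disjoint W (b.orthogonal W) := by
  rw [Submodule.disjoint_def]
  intro x hx hx'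
  by_contra h
  exact (hpos x h).ne' (LinearMap.BilinForm.mem_orthogonal_iff.mp hx' x hx)

lemma apply_mem_orthogonal_ker_aeval (hf : ∀ x y, b (f x) (f y) = b x y) {e : ℕ}
    (he : f ^ (e + 1) = 1) {g : ℤ[X]} {x : V}
    (hx : x ∈ b.orthogonal (LinearMap.ker (aeval f g))) :
    f x ∈ b.orthogonal (LinearMap.ker (aeval f g)) := by
  rw [LinearMap.BilinForm.mem_orthogonal_iff] at hx ⊢
  intro w hw
  have h1 : w = f ((f ^ e) w) := by
    rw [← Module.End.mul_apply, ← pow_succ', he, Module.End.one_apply]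
  have h2 := apply_mem_ker_aeval g hw (X ^ e)
  rw [map_pow, aeval_X] at h2
  have := hx _ h2
  rwa [← hf, ← h1] at this

/-- If `f` is an isometry of finite order killed by `g * h`, then `h (f)` kills the orthogonal
complement of the kernel of `g (f)`. -/
lemma aeval_apply_eq_zero_of_mem_orthogonal (hpos : ∀ v, v ≠ 0 → 0 < b v v)
    (hf : ∀ x y, b (f x) (f y) = b x y) {e : ℕ} (he : f ^ (e + 1) = 1) {g h : ℤ[X]}
    (hgh : aeval f (g * h) = 0) {x : V} (hx : x ∈ b.orthogonal (LinearMap.ker (aeval f g))) :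
    aeval f h x = 0 := by
  refine (Submodule.disjoint_def.mp (disjoint_orthogonal hpos _)) _ ?_
    (aeval_apply_mem (fun _ ↦ apply_mem_orthogonal_ker_aeval hf he) h hx)
  rw [LinearMap.mem_ker, ← aeval_mul_apply, hgh, LinearMap.zero_apply]

lemma natDegree_le_finrank [FiniteDimensional ℚ V] {U : Submodule ℚ V} (hU : U ≠ ⊥) {F : ℤ[X]}
    (hF : F.Monic) (hirr : Irreducible F) (hker : ∀ u ∈ U, aeval f F u = 0)
    (hstable : ∀ u ∈ U, f u ∈ U) : F.natDegree ≤ Module.finrank ℚ U := by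
  obtain ⟨u, hu, hu0⟩ := U.ne_bot_iff.mp hU
  have hirr' := (hF.irreducible_iff_irreducible_map_fraction_map (K := ℚ)).mp hirr
  have hstable' (g : ℚ[X]) : aeval f g u ∈ U := by
    have hpow (k : ℕ) : (f ^ k) u ∈ U := by
      have := aeval_apply_mem hstable (X ^ k) hu
      rwa [map_pow, aeval_X] at this
    rw [aeval_eq_sum_range, LinearMap.sum_apply]
    exact U.sum_mem fun i _ ↦ U.smul_mem _ (hpow i)
  let φ : degreeLT ℚ F.natDegree →ₗ[ℚ] U :=
    (((LinearMap.applyₗ u) ∘ₗ (aeval f).toLinearMap).codRestrict U hstable').domRestrict _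
  have hφ : Function.Injective φ := by
    rw [injective_iff_map_eq_zero]
    rintro ⟨g, hg⟩ h0
    have hg0 : aeval f g u = 0 := congrArg Subtype.val h0
    refine Subtype.ext ?_
    change g = 0
    by_contra hne
    have hcop : IsCoprime (F.map (algebraMap ℤ ℚ)) g := by
      refine hirr'.coprime_iff_not_dvd.mpr fun hd ↦ ?_
      have h1 := natDegree_le_of_dvd hd hne
      rw [hF.natDegree_map] at h1
      have h2 := (mem_degreeLT.mp hg)
      rw [degree_eq_natDegree hne, Nat.cast_lt] at h2
      omega
    obtain ⟨x, y, hxy⟩ := hcop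
    apply hu0
    have h1 : aeval f (F.map (algebraMap ℤ ℚ)) u = 0 := by
      rw [aeval_map_algebraMap, hker u hu]
    have h2 := congrArg (fun k ↦ aeval f k u) hxy
    simpa only [map_add, map_mul, LinearMap.add_apply, Module.End.mul_apply, h1, hg0, map_zero,
      add_zero, map_one, Module.End.one_apply] using h2.symm
  have := LinearMap.finrank_le_finrank_of_injective hφ
  rwa [(degreeLTEquiv ℚ F.natDegree).finrank_eq, Module.finrank_fin_fun] at this

end Isometry

section Charpoly

variable {ι : Type*} [Fintype ι] [DecidableEq ι]

/-- Every polynomial killing a matrix vanishes at all roots of its characteristic polynomial. -/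
lemma aeval_eq_zero_of_aeval_charpoly_eq_zero {T : Matrix ι ι ℤ} {g : ℤ[X]} (hg : aeval T g = 0)
    {ζ : ℂ} (hζ : aeval ζ T.charpoly = 0) : aeval ζ g = 0 := by
  let φ := (Int.castRingHom ℂ).mapMatrix (m := ι)
  have h1 : ζ ∈ spectrum ℂ (φ T) := by
    rw [Matrix.mem_spectrum_iff_isRoot_charpoly]
    have : (φ T).charpoly = T.charpoly.map (Int.castRingHom ℂ) := Matrix.charpoly_map T _
    rw [this, IsRoot.def, eval_map]
    exact hζ
  have h2 := spectrum.subset_polynomial_aeval (φ T) (g.map (algebraMap ℤ ℂ)) ⟨ζ, h1, rfl⟩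
  have h3 : aeval (φ T) (g.map (algebraMap ℤ ℂ)) = 0 := by
    rw [aeval_map_algebraMap]
    have := aeval_algHom_apply φ.toIntAlgHom T g
    rw [hg, map_zero] at this
    exact this
  cases subsingleton_or_nontrivial (Matrix ι ι ℂ)
  · simp [spectrum.of_subsingleton] at h1
  · rw [h3, spectrum.zero_eq] at h2
    rw [← aeval_map_algebraMap ℂ, coe_aeval_eq_eval]
    exact h2

end Charpoly

section Main

lemma bilin_aeval_gaussPoly {V : Type*} [AddCommGroup V] [Module ℚ V]
    {b : LinearMap.BilinForm ℚ V} {S : Module.End ℚ V} (hS : ∀ x y, b (S x) (S y) = b x y)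
    {p : ℕ} [Fact p.Prime] (hp4 : p % 4 = 3) (hSp : S ^ p = 1) (x y : V) :
    b (aeval S (gaussPoly p) x) y = -b x (aeval S (gaussPoly p) y) := by
  have hgauss (z : V) : aeval S (gaussPoly p) z =
      ∑ a : ZMod p, quadraticChar (ZMod p) a • (S ^ a.val) z := by
    simp [gaussPoly, LinearMap.sum_apply]
  have hneg (a : ZMod p) : quadraticChar (ZMod p) (-a) = -quadraticChar (ZMod p) a := by
    have h1 : quadraticChar (ZMod p) (-1) = -1 := by
      rw [quadraticChar_neg_one (by rw [ZMod.ringChar_zmod_n]; rintro rfl; omega), ZMod.card,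
        ZMod.χ₄_nat_three_mod_four hp4]
    rw [← neg_one_mul, map_mul, h1, neg_one_mul]
  have hadj (a : ZMod p) : b ((S ^ a.val) x) y = b x ((S ^ (-a).val) y) := by
    have hd : p ∣ a.val + (-a).val := by
      rw [← ZMod.natCast_eq_zero_iff]
      simp
    have h1 : (S ^ a.val) ((S ^ (-a).val) y) = y := by
      obtain ⟨c, hc⟩ := hd
      rw [← Module.End.mul_apply, ← pow_add, hc, pow_mul, hSp, one_pow, Module.End.one_apply]
    conv_lhs => rw [← h1]
    exact isometry_pow hS _ _ _
  rw [hgauss, hgauss, map_sum, map_sum, LinearMap.sum_apply, ← Finset.sum_neg_distrib,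
    ← Equiv.sum_comp (Equiv.neg (ZMod p))]
  refine Finset.sum_congr rfl fun a _ ↦ ?_
  rw [Equiv.neg_apply, hneg, map_zsmul, map_zsmul, LinearMap.smul_apply, hadj, neg_neg, neg_smul]

/-- The kernel of the first cyclotomic factor has the expected dimension. -/
lemma finrank_ker_aeval_cyclotomic {ι : Type*} [Fintype ι] [DecidableEq ι] {T : Matrix ι ι ℤ}
    {b : LinearMap.BilinForm ℚ (ι → ℚ)} (hsymm : LinearMap.IsSymm b)
    (hpos : ∀ v, v ≠ 0 → 0 < b v v)
    (hf : ∀ x y, b (ratEnd ι T x) (ratEnd ι T y) = b x y) {k l e : ℕ} (hk : 0 < k) (hl : 0 < l)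
    (hkl : k ≠ l) (he : ratEnd ι T ^ (e + 1) = 1)
    (hT : T.charpoly = cyclotomic k ℤ * cyclotomic l ℤ) :
    Module.finrank ℚ (LinearMap.ker (aeval (ratEnd ι T) (cyclotomic k ℤ))) = k.totient := by
  set f := ratEnd ι T with hfdef
  set W := LinearMap.ker (aeval f (cyclotomic k ℤ)) with hW
  have haeval (g : ℤ[X]) : aeval f g = ratEnd ι (aeval T g) := aeval_algHom_apply (ratEnd ι) T g
  have hzero : aeval f (cyclotomic k ℤ * cyclotomic l ℤ) = 0 := by
    rw [haeval, ← hT, aeval_self_charpoly, map_zero]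
  have hperp {x} (hx : x ∈ b.orthogonal W) : aeval f (cyclotomic l ℤ) x = 0 :=
    aeval_apply_eq_zero_of_mem_orthogonal hpos hf he hzero hx
  have hstable : ∀ x ∈ b.orthogonal W, f x ∈ b.orthogonal W := fun x hx ↦
    apply_mem_orthogonal_ker_aeval hf he hx
  have hroot {i : ℕ} (hi : 0 < i) (hdvd : cyclotomic i ℤ ∣ T.charpoly) {g : ℤ[X]}
      (hg : aeval f g = 0) : cyclotomic i ℤ ∣ g := by
    have hζ := Complex.isPrimitiveRoot_exp i hi.ne'
    refine cyclotomic_dvd_of_aeval_eq_zero hi hζ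
      (aeval_eq_zero_of_aeval_charpoly_eq_zero (T := T) ?_ ?_)
    · rw [haeval] at hg
      exact ratEnd_injective (by rw [hg, map_zero])
    · obtain ⟨c, hc⟩ := hdvd
      rw [hc, map_mul, cyclotomic_eq_minpoly hζ hi, minpoly.aeval, zero_mul]
  have hbot : W ≠ ⊥ := by
    intro hbot
    refine not_cyclotomic_dvd_cyclotomic hk hl hkl
      (hroot hk (hT ▸ dvd_mul_right _ _) (LinearMap.ext fun x ↦ ?_))
    rw [LinearMap.zero_apply, ← Submodule.mem_bot ℚ, ← hbot, hW, LinearMap.mem_ker,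
      ← aeval_mul_apply, hzero, LinearMap.zero_apply]
  have hrefl : b.IsRefl := hsymm.isRefl
  have hcompl : IsCompl W (b.orthogonal W) :=
    (LinearMap.BilinForm.isCompl_orthogonal_iff_disjoint hrefl).mpr (disjoint_orthogonal hpos W)
  have hbot' : b.orthogonal W ≠ ⊥ := by
    intro hbot'
    refine not_cyclotomic_dvd_cyclotomic hl hk hkl.symm
      (hroot hl (hT ▸ dvd_mul_left _ _) (LinearMap.ker_eq_top.mp ?_))
    have := hcompl.sup_eq_top
    rwa [hbot', sup_bot_eq] at this
  have h1 := natDegree_le_finrank hbot (cyclotomic.monic k ℤ) (cyclotomic.irreducible hk)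
    (fun u hu ↦ hu) (fun u hu ↦ aeval_X (R := ℤ) f ▸ apply_mem_ker_aeval _ hu X)
  have h2 := natDegree_le_finrank hbot' (cyclotomic.monic l ℤ) (cyclotomic.irreducible hl)
    (fun u hu ↦ hperp hu) hstable
  have h3 := Submodule.finrank_add_eq_of_isCompl hcompl
  have h4 := T.charpoly_natDegree_eq_dim
  rw [hT, (cyclotomic.monic k ℤ).natDegree_mul (cyclotomic.monic l ℤ)] at h4
  rw [Module.finrank_fintype_fun_eq_card, ← h4] at h3
  simp only [natDegree_cyclotomic] at h1 h2 h3
  omega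

/-- An even unimodular positive definite lattice has no isometry whose characteristic polynomial is
a product of two cyclotomic polynomials as below. -/
theorem no_isometry {ι : Type*} [Fintype ι] [DecidableEq ι] {p q : ℕ} [Fact p.Prime]
    [Fact q.Prime] (hpq : p ≠ q) (hp4 : p % 4 = 3) (hq4 : q % 4 = 3) {n m t : ℕ} (hn : 1 ≤ n)
    (htm : t < m) (hleg : legendreSym q p = -1) {B T : Matrix ι ι ℤ} (hB : B.IsSymm)
    (heven : ∀ i, Even (B i i)) (hpos : ∀ x, x ≠ 0 → 0 < x ⬝ᵥ B *ᵥ x) (hdet : B.det = 1)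
    (hBT : Tᵀ * B * T = B)
    (hT : T.charpoly = cyclotomic (p ^ n * q ^ m) ℤ * cyclotomic (p ^ n * q ^ t) ℤ) : False := by
  have hp : p.Prime := Fact.out
  have hq : q.Prime := Fact.out
  have hp0 := hp.pos
  have hq0 := hq.pos
  set f := ratEnd ι T with hfdef
  set b := gramForm B with hb
  have hsymm : LinearMap.IsSymm b := gramForm_isSymm hB
  have hbpos := gramForm_pos hpos
  have hne : p ^ n * q ^ m ≠ p ^ n * q ^ t := fun h ↦
    htm.ne' (Nat.pow_right_injective hq.two_le (mul_left_cancel₀ (pow_pos hp0 n).ne' h))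
  have haeval (g : ℤ[X]) : aeval f g = ratEnd ι (aeval T g) := aeval_algHom_apply (ratEnd ι) T g
  have hzero {g : ℤ[X]} (h1 : cyclotomic (p ^ n * q ^ m) ℤ ∣ g)
      (h2 : cyclotomic (p ^ n * q ^ t) ℤ ∣ g) : aeval f g = 0 := by
    obtain ⟨c, rfl⟩ := cyclotomic_mul_cyclotomic_dvd (by positivity) (by positivity) hne h1 h2
    rw [haeval, ← hT, map_mul, aeval_self_charpoly, zero_mul, map_zero]
  have hf (x y) : b (f x) (f y) = b x y := by
    rw [hb, gramForm_apply, gramForm_apply, hfdef, ratEnd_apply, ratEnd_apply]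
    have h : (T.map (Int.cast : ℤ → ℚ))ᵀ * B.map (Int.cast : ℤ → ℚ) * T.map (Int.cast : ℤ → ℚ) =
        B.map (Int.cast : ℤ → ℚ) := by
      conv_rhs => rw [← hBT]
      have h1 := map_mul (Int.castRingHom ℚ).mapMatrix (Tᵀ * B) T
      rw [map_mul _ Tᵀ B] at h1
      exact h1.symm
    conv_rhs => rw [← h, ← mulVec_mulVec, ← mulVec_mulVec, dotProduct_mulVec, vecMul_transpose]
  have hdvd : p ^ n * q ^ t ∣ p ^ n * q ^ (m - 1) :=
    mul_dvd_mul_left _ (pow_dvd_pow _ (by omega))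
  have hDq : p ^ n * q ^ (m - 1) * q = p ^ n * q ^ m := by
    rw [mul_assoc, ← pow_succ, Nat.sub_add_cancel (by omega)]
  have hford : f ^ (p ^ n * q ^ m) = 1 := by
    have := hzero (g := X ^ (p ^ n * q ^ m) - 1) (cyclotomic.dvd_X_pow_sub_one _ _)
      ((cyclotomic.dvd_X_pow_sub_one _ _).trans
        (dvd_pow_sub_one_of_dvd (mul_dvd_mul_left _ (pow_dvd_pow _ htm.le))))
    simpa [sub_eq_zero] using this
  obtain ⟨e, he⟩ : ∃ e, p ^ n * q ^ m = e + 1 :=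
    Nat.exists_eq_add_of_lt (by positivity : 0 < p ^ n * q ^ m) |>.imp fun _ h ↦ by simpa using h
  have hford' := he ▸ hford
  set F := cyclotomic (p ^ n * q ^ m) ℤ with hF
  set W := LinearMap.ker (aeval f F) with hW
  have hWperp {x} (hx : x ∈ b.orthogonal W) : aeval f (cyclotomic (p ^ n * q ^ t) ℤ) x = 0 :=
    aeval_apply_eq_zero_of_mem_orthogonal hbpos hf hford'
      (hzero (dvd_mul_right _ _) (dvd_mul_left _ _)) hx
  obtain ⟨r, hr, hcop⟩ := exists_dvd_sq_add hq4 hleg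
  set G := expand ℤ (p ^ (n - 1) * q ^ m) (gaussPoly p) with hG
  have hGS : aeval f G = aeval (f ^ (p ^ (n - 1) * q ^ m)) (gaussPoly p) := by
    rw [hG, expand_aeval]
  have hsq : aeval f (G ^ 2 + C (p : ℤ)) = 0 :=
    hzero (cyclotomic_dvd_expand_gaussPoly_sq hq hpq hp4 hn le_rfl)
      (cyclotomic_dvd_expand_gaussPoly_sq hq hpq hp4 hn htm.le)
  have hrefl : b.IsRefl := hsymm.isRefl
  have hcompl : IsCompl W (b.orthogonal W) :=
    (LinearMap.BilinForm.isCompl_orthogonal_iff_disjoint hrefl).mpr (disjoint_orthogonal hbpos W)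
  obtain ⟨L', hL'⟩ := (isEvenUnimodular_intLattice hB heven hpos hdet).exists_restrict hsymm
    (W := W) (γ := aeval f G) (p := p) (q := q) (r := r)
    (fun v hv ↦ by rw [haeval]; exact ratEnd_mem_intLattice _ hv)
    (fun v hv ↦ apply_mem_ker_aeval F hv G)
    (fun x y ↦ by
      rw [hGS]
      refine bilin_aeval_gaussPoly (isometry_pow hf _) hp4 ?_ x y
      rw [← pow_mul, ← hford]
      congr 1
      obtain ⟨n, rfl⟩ := Nat.exists_eq_add_of_le' hn
      rw [Nat.add_sub_cancel]
      ring)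
    (fun x ↦ by
      have := LinearMap.congr_fun hsq x
      rw [map_add, pow_two, map_mul, aeval_C] at this
      exact eq_neg_of_add_eq_zero_left (by simpa using this))
    (by exact_mod_cast Nat.odd_iff.mpr (by omega : q % 2 = 1)) hcop hr
    (fun l ↦ by
      obtain ⟨v, hv, w, hw, rfl⟩ := Submodule.mem_sup.mp
        (hcompl.sup_eq_top ▸ Submodule.mem_top : l ∈ W ⊔ b.orthogonal W)
      refine ⟨v, hv, fun x hx ↦ ?_⟩
      rw [add_sub_cancel_left]
      exact hrefl _ _ (hw x hx))
    (fun l hl v hv hlv ↦ by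
      have hw : l - v ∈ b.orthogonal W := fun x hx ↦ hrefl _ _ (hlv x hx)
      let D := p ^ n * q ^ (m - 1)
      let Ψ : ℤ[X] := ∑ j ∈ Finset.range q, (X ^ D) ^ j
      have h1 : aeval f Ψ v = 0 := by
        refine aeval_apply_eq_zero_of_dvd ?_ (LinearMap.mem_ker.mp hv)
        rw [hF, ← hDq]
        exact cyclotomic_dvd_sum_X_pow (by positivity) hq.one_lt
      have h2 : aeval f Ψ (l - v) = q • (l - v) := by
        have h3 : aeval f (X ^ D - 1 : ℤ[X]) (l - v) = 0 := aeval_apply_eq_zero_of_dvd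
          ((cyclotomic.dvd_X_pow_sub_one _ _).trans (dvd_pow_sub_one_of_dvd hdvd)) (hWperp hw)
        have h4 : (f ^ D) (l - v) = l - v := by
          rwa [map_sub (aeval (R := ℤ) f), map_pow, aeval_X, map_one, LinearMap.sub_apply, Module.End.one_apply,
            sub_eq_zero] at h3
        have h5 (j : ℕ) : ((f ^ D) ^ j) (l - v) = l - v := by
          rw [Module.End.pow_apply]
          exact Function.iterate_fixed h4 j
        simp only [Ψ, map_sum, map_pow, aeval_X, LinearMap.sum_apply, h5, Finset.sum_const,
          Finset.card_range]
      have h4 : aeval f Ψ l ∈ intLattice ι := by rw [haeval]; exact ratEnd_mem_intLattice _ hl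
      have h5 : (q : ℤ) • v = (q : ℤ) • l - aeval f Ψ l := by
        rw [map_sub, h1, sub_zero] at h2
        rw [h2, natCast_zsmul, natCast_zsmul, smul_sub, sub_sub_cancel]
      rw [h5]
      exact AddSubgroup.sub_mem _ (AddSubgroup.zsmul_mem _ hl _) h4)
    (fun v hv hvl ↦ by
      rw [hW, haeval] at hvl ⊢
      exact exists_mem_intLattice_sub_ortho hdet _ v hvl)
  have h8 := hL'.eight_dvd_finrank
    ⟨fun x y ↦ hsymm.eq x y⟩ fun v hv ↦ hbpos v (by simpa using hv)
  rw [hW, finrank_ker_aeval_cyclotomic hsymm hbpos hf (by positivity) (by positivity) hne hford' hT]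
    at h8
  exact not_eight_dvd_totient hp hq hpq hp4 hq4 hn (by omega) h8

end Main

theorem stmt_11 (p q : ℕ) (hp : p.Prime) [Fact q.Prime] (hpq : p ≠ q)
    (hp4 : p % 4 = 3) (hq4 : q % 4 = 3)
    (n m t : ℕ) (hn : 1 ≤ n) (hm : 1 ≤ m) (ht : 1 ≤ t) (hmt : m ≠ t)
    (hleg : legendreSym q p = -1) :
    ¬ ∃ B T : Matrix (Fin ((cyclotomic (p ^ n * q ^ m) ℤ * cyclotomic (p ^ n * q ^ t) ℤ).natDegree))
        (Fin ((cyclotomic (p ^ n * q ^ m) ℤ * cyclotomic (p ^ n * q ^ t) ℤ).natDegree)) ℤ,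
      B.IsSymm ∧ (∀ i, Even (B i i)) ∧
      (∀ x, x ≠ 0 → 0 < x ⬝ᵥ B.mulVec x) ∧
      B.det = 1 ∧ Tᵀ * B * T = B ∧
      T.charpoly = cyclotomic (p ^ n * q ^ m) ℤ * cyclotomic (p ^ n * q ^ t) ℤ := by
  rintro ⟨B, T, hB, heven, hpos, hdet, hBT, hT⟩
  have := Fact.mk hp
  rcases hmt.lt_or_gt with h | h
  · exact no_isometry hpq hp4 hq4 hn h hleg hB heven hpos hdet hBT (hT.trans (mul_comm _ _))
  · exact no_isometry hpq hp4 hq4 hn h hleg hB heven hpos hdet hBT hT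
end

section
/- Let m and m′ be odd integers with 3 ≤ m < m′, and let p be a prime number. The reductions modulo p of the cyclotomic polynomials Φ_m and Φ_{m′} have a common nonconstant factor in 𝔽_p[X] (equivalently, they are not coprime in 𝔽_p[X]) if and only if m′ = m·p^e for some integer e ≥ 1. -/
open Polynomial

/-- In characteristic `p`, the polynomial `Φ_n` divides `Φ_{n p ^ e}`. -/
lemma cyclotomic_dvd_cyclotomic_mul_prime_pow (R : Type*) [CommRing R] {p : ℕ}
    [hp : Fact p.Prime] [CharP R p] (n e : ℕ) :
    cyclotomic n R ∣ cyclotomic (n * p ^ e) R := by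
  induction e with
  | zero => simp
  | succ e ih =>
    refine ih.trans ?_
    rw [pow_succ, ← mul_assoc]
    by_cases hdvd : p ∣ n * p ^ e
    · rw [cyclotomic_mul_prime_dvd_eq_pow R hdvd]
      exact dvd_pow_self _ hp.out.ne_zero
    · rw [cyclotomic_mul_prime_eq_pow_of_not_dvd R hdvd]
      exact dvd_pow_self _ (Nat.sub_ne_zero_of_lt hp.out.one_lt)

/-- A common root of `Φ_m` and `Φ_n` in characteristic `p` forces `m` and `n` to have the same
prime-to-`p` part. -/
lemma ordCompl_eq_of_isRoot_cyclotomic {R : Type*} [CommRing R] [IsDomain R] {p : ℕ}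
    [hp : Fact p.Prime] [CharP R p] {m n : ℕ} (hm : m ≠ 0) (hn : n ≠ 0) {μ : R}
    (hμm : (cyclotomic m R).IsRoot μ) (hμn : (cyclotomic n R).IsRoot μ) :
    ordCompl[p] m = ordCompl[p] n := by
  have primitive {k : ℕ} (hk : k ≠ 0) (h : (cyclotomic k R).IsRoot μ) :
      IsPrimitiveRoot μ (ordCompl[p] k) := by
    have : NeZero ((ordCompl[p] k : ℕ) : R) :=
      ⟨fun h0 => Nat.not_dvd_ordCompl hp.out hk ((CharP.cast_eq_zero_iff R p _).1 h0)⟩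
    rw [← Nat.ordProj_mul_ordCompl_eq_self k p] at h
    exact isRoot_cyclotomic_prime_pow_mul_iff_of_charP.1 h
  exact (primitive hm hμm).unique (primitive hn hμn)

theorem stmt_12 (m m' : ℕ) (hm : Odd m) (hm' : Odd m') (h3 : 3 ≤ m) (hlt : m < m')
    (p : ℕ) (hp : p.Prime) :
    (∃ h : Polynomial (ZMod p), 0 < h.natDegree ∧
        h ∣ (cyclotomic m ℤ).map (Int.castRingHom (ZMod p)) ∧
        h ∣ (cyclotomic m' ℤ).map (Int.castRingHom (ZMod p))) ↔
      ∃ e : ℕ, 1 ≤ e ∧ m' = m * p ^ e := by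
  have : Fact p.Prime := ⟨hp⟩
  simp only [map_cyclotomic]
  constructor
  · rintro ⟨h, hdeg, hdvd, hdvd'⟩
    obtain ⟨μ, hμ⟩ := IsAlgClosed.exists_aeval_eq_zero (AlgebraicClosure (ZMod p)) h
      (natDegree_pos_iff_degree_pos.1 hdeg).ne'
    have : CharP (AlgebraicClosure (ZMod p)) p := charP_of_injective_algebraMap
      (algebraMap (ZMod p) (AlgebraicClosure (ZMod p))).injective p
    have isRoot {k : ℕ} (hk : h ∣ cyclotomic k (ZMod p)) :
        (cyclotomic k (AlgebraicClosure (ZMod p))).IsRoot μ := by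
      have := aeval_eq_zero_of_dvd_aeval_eq_zero hk hμ
      rwa [aeval_def, eval₂_eq_eval_map, map_cyclotomic] at this
    have hcompl : ordCompl[p] m = ordCompl[p] m' :=
      ordCompl_eq_of_isRoot_cyclotomic (by omega) (by omega) (isRoot hdvd) (isRoot hdvd')
    have hfac := Nat.ordProj_mul_ordCompl_eq_self m p
    have hfac' := Nat.ordProj_mul_ordCompl_eq_self m' p
    rw [← hcompl] at hfac'
    generalize m / p ^ m.factorization p = r at hfac hfac'
    have hexp : m.factorization p < m'.factorization p := by
      by_contra! hle
      have := Nat.mul_le_mul_right r (Nat.pow_le_pow_right hp.pos hle)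
      omega
    refine ⟨m'.factorization p - m.factorization p, by omega, ?_⟩
    calc m' = p ^ m'.factorization p * r := hfac'.symm
      _ = p ^ m.factorization p * r * p ^ (m'.factorization p - m.factorization p) := by
        rw [mul_right_comm, ← pow_add, Nat.add_sub_cancel' hexp.le]
      _ = m * p ^ (m'.factorization p - m.factorization p) := by rw [hfac]
  · rintro ⟨e, -, rfl⟩
    refine ⟨cyclotomic m (ZMod p), ?_, dvd_rfl, cyclotomic_dvd_cyclotomic_mul_prime_pow _ m e⟩
    rw [natDegree_cyclotomic]
    exact Nat.totient_pos.2 (by omega)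
end

section
/- Let m ≥ 3 be an odd integer and let p be an odd prime number not dividing m. The following are equivalent: (a) the reduction of the cyclotomic polynomial Φ_m modulo p has a monic irreducible symmetric factor in 𝔽_p[X], i.e. there exists a monic irreducible polynomial h ∈ 𝔽_p[X] of even degree with palindromic coefficients (h equals its reverse) dividing Φ_m mod p; (c) the subgroup of (ℤ/mℤ)× generated by p contains −1, i.e. there exists k ∈ ℕ with p^k ≡ −1 (mod m). -/
open Polynomial

/-- The nonzero roots of the reverse of a polynomial are the inverses of its nonzero roots. -/
theorem aeval_inv_reverse_eq_zero_iff {F L : Type*} [Field F] [Field L] [Algebra F L]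
    {x : L} (hx : x ≠ 0) (f : F[X]) : aeval x⁻¹ f.reverse = 0 ↔ aeval x f = 0 := by
  let _ := invertibleOfNonzero hx
  rw [← invOf_eq_inv x]
  exact eval₂_reverse_eq_zero_iff (algebraMap F L) x f

/-- Over a finite field, any two roots of an irreducible polynomial are related by a power of
the Frobenius. -/
theorem exists_root_pow_card_pow_eq {F : Type*} [Field F] [Fintype F] {h : F[X]}
    [Fact (Irreducible h)] {y : AdjoinRoot h} (hy : aeval y h = 0) :
    ∃ k : ℕ, AdjoinRoot.root h ^ Fintype.card F ^ k = y := by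
  have hne : h ≠ 0 := (Fact.out : Irreducible h).ne_zero
  have : Module.Finite F (AdjoinRoot h) := (AdjoinRoot.powerBasis hne).finite
  have : Finite (AdjoinRoot h) := Module.finite_of_finite F
  obtain ⟨k, hk⟩ := (FiniteField.bijective_frobeniusAlgHom_pow F (AdjoinRoot h)).2
    (AdjoinRoot.liftAlgHom h (Algebra.ofId F (AdjoinRoot h)) y hy)
  refine ⟨k, ?_⟩
  have := (DFunLike.congr_fun hk (AdjoinRoot.root h)).trans (AdjoinRoot.liftAlgHom_root ..)
  simpa [AlgHom.coe_pow, FiniteField.coe_frobeniusAlgHom, pow_iterate] using this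

/-- An irreducible monic polynomial of degree other than one which divides its reverse is
palindromic. -/
theorem reverse_eq_self_of_dvd_reverse {F : Type*} [Field F] {h : F[X]} (hmonic : h.Monic)
    (hirr : Irreducible h) (hdeg : h.natDegree ≠ 1) (hdvd : h ∣ h.reverse) :
    h.reverse = h := by
  have hrev : h.reverse = C h.reverse.leadingCoeff * h :=
    eq_leadingCoeff_mul_of_monic_of_dvd_of_natDegree_le hmonic hdvd (reverse_natDegree_le h)
  have heval : h.reverse.eval 1 = h.eval 1 := by
    let _ : Invertible (1 : F) := invertibleOne
    have := eval₂_reverse_mul_pow (RingHom.id F) 1 h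
    simpa [eval₂_id] using this
  have hne : h.eval 1 ≠ 0 := fun h0 ↦
    hdeg (natDegree_eq_of_degree_eq_some (degree_eq_one_of_irreducible_of_root hirr h0))
  have hlc : h.reverse.leadingCoeff = 1 := by
    rw [hrev, eval_mul, eval_C] at heval
    exact (mul_eq_right₀ hne).1 heval
  rw [hrev, hlc, C_1, one_mul]

/-- An element with `-1` among its powers has even order, provided `-1 ≠ 1`. -/
theorem even_orderOf_of_pow_eq_neg_one {R : Type*} [Ring R] {x : R} {k : ℕ}
    (hR : (-1 : R) ≠ 1) (hk : x ^ k = -1) : Even (orderOf x) := by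
  by_contra hodd
  have hdvd : orderOf x ∣ k * 2 := orderOf_dvd_of_pow_eq_one (by rw [pow_mul, hk, neg_one_sq])
  have hdvd' := (Nat.Coprime.dvd_mul_right
    (Nat.coprime_two_right.2 (Nat.not_even_iff_odd.1 hodd))).1 hdvd
  exact hR (hk ▸ orderOf_dvd_iff_pow_eq_one.1 hdvd')

/-- The root adjoined by an irreducible factor of a cyclotomic polynomial is a primitive root
of unity. -/
theorem isPrimitiveRoot_root_of_dvd_cyclotomic {F : Type*} [Field F] {m : ℕ} [NeZero (m : F)]
    {h : F[X]} [Fact (Irreducible h)] (hdvd : h ∣ cyclotomic m F) :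
    IsPrimitiveRoot (AdjoinRoot.root h) m := by
  have : NeZero (m : AdjoinRoot h) := by
    simpa using NeZero.of_injective (a := (m : F)) (algebraMap F (AdjoinRoot h)).injective
  rw [← isRoot_cyclotomic_iff, ← map_cyclotomic m (algebraMap F (AdjoinRoot h)), IsRoot.def,
    eval_map_algebraMap, AdjoinRoot.aeval_eq, AdjoinRoot.mk_eq_zero]
  exact hdvd

/-- For a primitive `m`-th root of unity `ζ`, raising to the power `n` inverts `ζ` exactly when
`n` is `-1` modulo `m`. -/
theorem IsPrimitiveRoot.pow_eq_inv_iff_natCast_eq_neg_one {L : Type*} [Field L] {ζ : L} {m : ℕ}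
    (hm : m ≠ 0) (hζ : IsPrimitiveRoot ζ m) (n : ℕ) : ζ ^ n = ζ⁻¹ ↔ (n : ZMod m) = -1 := by
  rw [← mul_eq_one_iff_eq_inv₀ (hζ.ne_zero hm), ← pow_succ, hζ.pow_eq_one_iff_dvd,
    ← ZMod.natCast_eq_zero_iff, Nat.cast_succ, eq_neg_iff_add_eq_zero]

theorem stmt_13 (m : ℕ) (hm3 : 3 ≤ m) (hmodd : Odd m)
    (p : ℕ) (hp : p.Prime) (hpodd : Odd p) (hpm : ¬ p ∣ m) :
    (∃ h : Polynomial (ZMod p), h.Monic ∧ Irreducible h ∧ Even h.natDegree ∧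
        h.reverse = h ∧ h ∣ (cyclotomic m ℤ).map (Int.castRingHom (ZMod p))) ↔
      ∃ k : ℕ, (p : ZMod m) ^ k = -1 := by
  have : Fact p.Prime := ⟨hp⟩
  have hm0 : m ≠ 0 := by omega
  have : NeZero (m : ZMod p) := ⟨by rwa [Ne, ZMod.natCast_eq_zero_iff]⟩
  rw [map_cyclotomic]
  constructor
  · rintro ⟨h, -, hirr, -, hrev, hdvd⟩
    have : Fact (Irreducible h) := ⟨hirr⟩
    have hζ := isPrimitiveRoot_root_of_dvd_cyclotomic hdvd
    have hinv := (aeval_inv_reverse_eq_zero_iff (hζ.ne_zero hm0) h).2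
      (by simp [AdjoinRoot.aeval_eq])
    rw [hrev] at hinv
    obtain ⟨k, hk⟩ := exists_root_pow_card_pow_eq hinv
    rw [ZMod.card] at hk
    exact ⟨k, by exact_mod_cast (hζ.pow_eq_inv_iff_natCast_eq_neg_one hm0 _).1 hk⟩
  · rintro ⟨k, hk⟩
    have hcop : p.Coprime m := hp.coprime_iff_not_dvd.2 hpm
    obtain ⟨h, hmonic, hirr, hdvd⟩ := exists_monic_irreducible_factor (cyclotomic m (ZMod p))
      (not_isUnit_of_degree_pos _ (degree_cyclotomic_pos m _ (by omega)))
    have : Fact (Irreducible h) := ⟨hirr⟩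
    have hζ := isPrimitiveRoot_root_of_dvd_cyclotomic hdvd
    have heven : Even h.natDegree := by
      have : Fact (2 < m) := ⟨hm3⟩
      rw [natDegree_of_dvd_cyclotomic_of_irreducible (p := p) (f := 1) (by simp) hcop hdvd hirr,
        ← orderOf_units]
      simpa using even_orderOf_of_pow_eq_neg_one ZMod.neg_one_ne_one hk
    refine ⟨h, hmonic, hirr, heven, ?_, hdvd⟩
    refine reverse_eq_self_of_dvd_reverse hmonic hirr (fun h1 ↦ by simp [h1] at heven) ?_
    have hpow := (hζ.pow_eq_inv_iff_natCast_eq_neg_one hm0 (p ^ k)).2 (by exact_mod_cast hk)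
    have hroot : aeval (AdjoinRoot.root h)⁻¹ h = 0 := by
      have := congrArg (FiniteField.frobeniusAlgHom (ZMod p) (AdjoinRoot h) ^ k)
        (show aeval (AdjoinRoot.root h) h = 0 by simp [AdjoinRoot.aeval_eq])
      rw [← aeval_algHom_apply, map_zero] at this
      simpa [AlgHom.coe_pow, FiniteField.coe_frobeniusAlgHom, pow_iterate, hpow] using this
    rw [← AdjoinRoot.mk_eq_zero, ← AdjoinRoot.aeval_eq]
    simpa using (aeval_inv_reverse_eq_zero_iff (inv_ne_zero (hζ.ne_zero hm0)) h).2 hroot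
end

section
/- Let m be a prime number with m ≡ 3 (mod 4) and let p be an odd prime number with p ≠ m. Then the reduction of the cyclotomic polynomial Φ_m modulo p has a monic irreducible symmetric factor in 𝔽_p[X] if and only if the Legendre symbol (p/m) equals −1. -/
open Polynomial

/-- A monic irreducible polynomial of degree other than one that has both `x` and `x⁻¹` as roots
in an extension field is its own reverse. -/
theorem Polynomial.reverse_eq_self_of_aeval_inv_eq_zero {K L : Type*} [Field K] [Field L]
    [Algebra K L] {h : K[X]} (hmonic : h.Monic) (hirr : Irreducible h) (hdeg : h.natDegree ≠ 1)
    {x : L} (hx0 : x ≠ 0) (hx : aeval x h = 0) (hxinv : aeval x⁻¹ h = 0) :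
    h.reverse = h := by
  have hdvd : h ∣ h.reverse := by
    rw [minpoly.eq_of_irreducible_of_monic hirr hx hmonic] at hxinv ⊢
    apply minpoly.dvd
    let _ := invertibleOfNonzero (inv_ne_zero hx0)
    have key := (eval₂_reverse_eq_zero_iff (algebraMap K L) x⁻¹ (minpoly K x)).2 hxinv
    rwa [invOf_eq_inv, inv_inv] at key
  have heq := eq_mul_leadingCoeff_of_monic_of_dvd_of_natDegree_le hmonic hdvd
    (reverse_natDegree_le h)
  have hone : h.eval 1 ≠ 0 := fun h1 ↦
    hdeg (natDegree_eq_of_degree_eq_some (degree_eq_one_of_irreducible_of_root hirr h1))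
  have hrev : h.reverse.eval 1 = h.eval 1 := by
    let _ : Invertible (1 : K) := invertibleOne
    simpa [eval₂_id] using eval₂_reverse_mul_pow (RingHom.id K) 1 h
  have hlead : h.reverse.leadingCoeff = 1 := by
    have hev := congrArg (eval 1) heq
    rw [hrev, eval_mul, eval_C] at hev
    exact mul_left_cancel₀ hone (by rw [← hev, mul_one])
  rwa [hlead, C_1, mul_one] at heq

theorem ZMod.aeval_pow_char_pow {p : ℕ} [Fact p.Prime] {A : Type*} [CommRing A]
    [Algebra (ZMod p) A] (f : (ZMod p)[X]) (x : A) (k : ℕ) :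
    aeval (x ^ p ^ k) f = aeval x f ^ p ^ k := by
  induction k with
  | zero => simp
  | succ k ih => rw [pow_succ, pow_mul, ← expand_aeval, ZMod.expand_card, map_pow, ih, pow_mul]

theorem ZMod.even_orderOf_iff_legendreSym_eq_neg_one {m : ℕ} [Fact m.Prime] (hm4 : m % 4 = 3)
    {a : ℤ} {u : (ZMod m)ˣ} (hu : (u : ZMod m) = a) :
    Even (orderOf u) ↔ legendreSym m a = -1 := by
  have hodd : Odd (m / 2) := by rw [Nat.odd_iff]; omega
  have hpow : ((u ^ (m / 2) : (ZMod m)ˣ) : ZMod m) = legendreSym m a := by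
    rw [legendreSym.eq_pow, Units.val_pow_eq_pow_val, hu]
  have : Fact (2 < m) := ⟨by omega⟩
  constructor
  · intro heven
    refine (legendreSym.eq_one_or_neg_one m (hu ▸ u.ne_zero)).resolve_left fun h1 ↦ ?_
    have hu1 : u ^ (m / 2) = 1 := Units.ext (by simpa [h1] using hpow)
    exact Nat.not_even_iff_odd.2 (hodd.of_dvd_nat (orderOf_dvd_of_pow_eq_one hu1)) heven
  · intro hneg
    by_contra hnot
    have hdvd : orderOf u ∣ 2 * (m / 2) := by
      have := orderOf_dvd_of_pow_eq_one (ZMod.units_pow_card_sub_one_eq_one m u)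
      rwa [show m - 1 = 2 * (m / 2) by omega] at this
    have hu1 : u ^ (m / 2) = 1 := orderOf_dvd_iff_pow_eq_one.1
      (Nat.Coprime.dvd_of_dvd_mul_left
        (Nat.coprime_two_right.2 (Nat.not_even_iff_odd.1 hnot)) hdvd)
    rw [hu1, hneg] at hpow
    exact ZMod.neg_one_ne_one (n := m) (by simpa using hpow.symm)

theorem pow_eq_inv_of_natCast_eq_neg_one {m n : ℕ} {L : Type*} [Field L] {x : L}
    (hx : x ^ m = 1) (hn : (n : ZMod m) = -1) : x ^ n = x⁻¹ := by
  obtain ⟨j, hj⟩ : m ∣ n + 1 := by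
    rw [← ZMod.natCast_eq_zero_iff]; simp [hn]
  refine eq_inv_of_mul_eq_one_left ?_
  rw [← pow_succ, hj, pow_mul, hx, one_pow]

theorem stmt_14 (m : ℕ) [Fact m.Prime] (hm4 : m % 4 = 3)
    (p : ℕ) (hp : p.Prime) (hpodd : Odd p) (hpm : p ≠ m) :
    (∃ h : Polynomial (ZMod p), h.Monic ∧ Irreducible h ∧ Even h.natDegree ∧
        h.reverse = h ∧ h ∣ (cyclotomic m ℤ).map (Int.castRingHom (ZMod p))) ↔
      legendreSym m p = -1 := by
  have hm : m.Prime := Fact.out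
  have : Fact p.Prime := ⟨hp⟩
  have hcop : p.Coprime m := (Nat.coprime_primes hp hm).2 hpm
  have heven {h : (ZMod p)[X]} (hirr : Irreducible h) (hdvd : h ∣ cyclotomic m (ZMod p)) :
      Even h.natDegree ↔ legendreSym m p = -1 := by
    rw [natDegree_of_dvd_cyclotomic_of_irreducible (p := p) (f := 1) (by simp) hcop hdvd hirr]
    exact ZMod.even_orderOf_iff_legendreSym_eq_neg_one hm4 (by simp)
  rw [map_cyclotomic_int]
  constructor
  · rintro ⟨h, -, hirr, hdeg, -, hdvd⟩
    exact (heven hirr hdvd).1 hdeg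
  · intro hneg
    obtain ⟨h, hmonic, hirr, hdvd⟩ := exists_monic_irreducible_factor (cyclotomic m (ZMod p))
      (not_isUnit_of_natDegree_pos _
        (by rw [natDegree_cyclotomic]; exact Nat.totient_pos.2 hm.pos))
    have hdeg := (heven hirr hdvd).2 hneg
    refine ⟨h, hmonic, hirr, hdeg, ?_, hdvd⟩
    have : Fact (Irreducible h) := ⟨hirr⟩
    have hroot : aeval (AdjoinRoot.root h) h = 0 := by simp
    have hpow : AdjoinRoot.root h ^ m = 1 := by
      have := aeval_eq_zero_of_dvd_aeval_eq_zero (hdvd.trans (cyclotomic.dvd_X_pow_sub_one m _))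
        hroot
      simpa [sub_eq_zero] using this
    have hne : AdjoinRoot.root h ≠ 0 := by
      intro h0
      simp [h0, hm.ne_zero] at hpow
    have hfrob : ((p ^ (m / 2) : ℕ) : ZMod m) = -1 := by
      have := legendreSym.eq_pow m p
      rw [hneg] at this
      simpa using this.symm
    refine reverse_eq_self_of_aeval_inv_eq_zero hmonic hirr (by rintro h1; simp [h1] at hdeg)
      hne hroot ?_
    rw [← pow_eq_inv_of_natCast_eq_neg_one hpow hfrob, ZMod.aeval_pow_char_pow, hroot,
      zero_pow (pow_ne_zero _ hp.ne_zero)]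
end

section
/- Let p be a prime number with p ≡ 3 (mod 4). The following are equivalent: (a) there exist a prime number ℓ and a monic irreducible polynomial h ∈ 𝔽_ℓ[X] of even degree with palindromic coefficients (h equals its reverse) dividing both the reduction of Φ_p modulo ℓ and the reduction of Φ_{2p} modulo ℓ; (b) p ≡ 3 (mod 8). -/
open Polynomial

theorem ZMod.eq_two_of_two_eq_zero {p : ℕ} [Fact p.Prime] (hzero : (2 : ZMod p) = 0) : p = 2 := by
  have hdvd : p ∣ 2 := (ZMod.natCast_eq_zero_iff 2 p).mp (by exact_mod_cast hzero)
  exact (Nat.prime_dvd_prime_iff_eq Fact.out Nat.prime_two).mp hdvd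

/-- A prime modulus for which `Φ_p` and `Φ_{2p}` share an irreducible factor is `2`. -/
theorem eq_two_of_dvd_cyclotomic_of_dvd_cyclotomic_two_mul {p ℓ : ℕ} (hp : 0 < p)
    [Fact ℓ.Prime] {h : (ZMod ℓ)[X]} (hirr : Irreducible h)
    (h₁ : h ∣ cyclotomic p (ZMod ℓ)) (h₂ : h ∣ cyclotomic (2 * p) (ZMod ℓ)) : ℓ = 2 := by
  have hsub : h ∣ X ^ p - 1 := h₁.trans (cyclotomic.dvd_X_pow_sub_one p _)
  have hadd : h ∣ X ^ p + 1 := by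
    refine h₂.trans ?_
    have hmul := X_pow_sub_one_mul_cyclotomic_dvd_X_pow_sub_one_of_dvd (ZMod ℓ)
      (Nat.mem_properDivisors.mpr ⟨Dvd.intro_left 2 rfl, by lia⟩ : p ∈ (2 * p).properDivisors)
    have hfac : (X ^ (2 * p) - 1 : (ZMod ℓ)[X]) = (X ^ p - 1) * (X ^ p + 1) := by ring
    rw [hfac] at hmul
    exact (mul_dvd_mul_iff_left (monic_X_pow_sub_C (1 : ZMod ℓ) hp.ne').ne_zero).mp hmul
  have htwo : h ∣ C (2 : ZMod ℓ) := by
    have hdiff := dvd_sub hadd hsub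
    rwa [show (X ^ p + 1 - (X ^ p - 1) : (ZMod ℓ)[X]) = C 2 by rw [C_ofNat]; ring] at hdiff
  have hzero : (2 : ZMod ℓ) = 0 := by
    by_contra hne
    exact hirr.not_isUnit (isUnit_of_dvd_unit htwo (isUnit_C.mpr (isUnit_iff_ne_zero.mpr hne)))
  exact ZMod.eq_two_of_two_eq_zero hzero

/-- For a prime `p ≡ 3 (mod 4)`, Euler's criterion for `2`. -/
theorem two_pow_half_eq_one_iff {p : ℕ} [Fact p.Prime] (hp4 : p % 4 = 3) :
    (2 : ZMod p) ^ (p / 2) = 1 ↔ p % 8 ≠ 3 := by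
  have hp2 : p ≠ 2 := by rintro rfl; lia
  rw [← ZMod.euler_criterion p (mt ZMod.eq_two_of_two_eq_zero hp2), ZMod.exists_sq_eq_two_iff hp2]
  lia

/-- For a prime `p ≡ 3 (mod 4)`, the order of `2` modulo `p` is even iff `p ≡ 3 (mod 8)`. -/
theorem even_orderOf_two_iff {p : ℕ} [Fact p.Prime] (hp4 : p % 4 = 3) :
    Even (orderOf (2 : ZMod p)) ↔ p % 8 = 3 := by
  have hodd : Odd (p / 2) := by rw [Nat.odd_iff]; lia
  have hsq : ((2 : ZMod p) ^ (p / 2)) ^ 2 = 1 := by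
    rw [← pow_mul, show p / 2 * 2 = p - 1 by lia]
    refine ZMod.pow_card_sub_one_eq_one fun hzero => ?_
    have := ZMod.eq_two_of_two_eq_zero hzero
    lia
  rw [← not_iff_not, Nat.not_even_iff_odd, ← ne_eq, ← two_pow_half_eq_one_iff hp4]
  refine ⟨fun hord => ?_, fun hone => hodd.of_dvd_nat (orderOf_dvd_of_pow_eq_one hone)⟩
  rw [← orderOf_dvd_iff_pow_eq_one]
  rw [← pow_mul, ← orderOf_dvd_iff_pow_eq_one] at hsq
  exact (Nat.coprime_two_right.mpr hord).dvd_of_dvd_mul_right hsq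

/-- The degree of an irreducible factor of `Φ_p` modulo `2` is the order of `2` modulo `p`. -/
theorem natDegree_eq_orderOf_two {p : ℕ} (hp : Odd p) {h : (ZMod 2)[X]} (hirr : Irreducible h)
    (hdvd : h ∣ cyclotomic p (ZMod 2)) : h.natDegree = orderOf (2 : ZMod p) := by
  have hcard : Fintype.card (ZMod 2) = 2 ^ 1 := by simp
  rw [natDegree_of_dvd_cyclotomic_of_irreducible hcard (Nat.coprime_two_left.mpr hp) hdvd hirr,
    ← orderOf_units]
  simp

/-- If `-1` is a power of `2` modulo `n`, then irreducible factors of `Φ_n` modulo `2`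
are palindromic. -/
theorem reverse_eq_self_of_dvd_cyclotomic {n k : ℕ} (hk : n ∣ 2 ^ k + 1)
    {h : (ZMod 2)[X]} (hirr : Irreducible h) (hdvd : h ∣ cyclotomic n (ZMod 2)) :
    h.reverse = h := by
  have hmonic : ∀ f : (ZMod 2)[X], f ≠ 0 → f.Monic := fun f hf => by
    have := leadingCoeff_ne_zero.mpr hf
    rw [Monic]
    generalize f.leadingCoeff = c at *
    revert c; decide
  have : Fact (Irreducible h) := ⟨hirr⟩
  let ζ := AdjoinRoot.root h
  have hroot : aeval ζ h = 0 := by rw [AdjoinRoot.aeval_eq, AdjoinRoot.mk_self]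
  have hpow : ζ ^ n = 1 := by
    have hz := aeval_eq_zero_of_dvd_aeval_eq_zero
      (hdvd.trans (cyclotomic.dvd_X_pow_sub_one n (ZMod 2))) hroot
    simpa [sub_eq_zero] using hz
  have hinv : ζ ^ 2 ^ k * ζ = 1 := by
    obtain ⟨m, hm⟩ := hk
    rw [← pow_succ, hm, pow_mul, hpow, one_pow]
  have hfrob : aeval (ζ ^ 2 ^ k) h = 0 := by
    have hcomp := aeval_algHom_apply (FiniteField.frobeniusAlgHom (ZMod 2) (AdjoinRoot h) ^ k) ζ h
    rw [hroot, map_zero, AlgHom.coe_pow, FiniteField.coe_frobeniusAlgHom, pow_iterate,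
      ZMod.card] at hcomp
    exact hcomp
  let := invertibleOfNonzero (left_ne_zero_of_mul_eq_one hinv)
  have hrev : aeval ζ h.reverse = 0 := by
    have := (eval₂_reverse_eq_zero_iff (algebraMap (ZMod 2) (AdjoinRoot h)) (ζ ^ 2 ^ k) h).mpr hfrob
    rwa [invOf_eq_right_inv hinv] at this
  have hh : h ∣ h.reverse := by rwa [AdjoinRoot.aeval_eq, AdjoinRoot.mk_eq_zero] at hrev
  have hne : h.reverse ≠ 0 := by simpa using hirr.ne_zero
  exact eq_of_monic_of_dvd_of_natDegree_le (hmonic h hirr.ne_zero) (hmonic _ hne) hh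
    (reverse_natDegree_le h)

theorem stmt_15 (p : ℕ) (hp : p.Prime) (hp4 : p % 4 = 3) :
    (∃ ℓ : ℕ, ℓ.Prime ∧ ∃ h : Polynomial (ZMod ℓ), h.Monic ∧ Irreducible h ∧
        Even h.natDegree ∧ h.reverse = h ∧
        h ∣ (cyclotomic p ℤ).map (Int.castRingHom (ZMod ℓ)) ∧
        h ∣ (cyclotomic (2 * p) ℤ).map (Int.castRingHom (ZMod ℓ))) ↔
      p % 8 = 3 := by
  have : Fact p.Prime := ⟨hp⟩
  have hodd : Odd p := by rw [Nat.odd_iff]; lia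
  simp only [map_cyclotomic]
  constructor
  · rintro ⟨ℓ, hℓ, h, -, hirr, heven, -, h₁, h₂⟩
    have : Fact ℓ.Prime := ⟨hℓ⟩
    obtain rfl := eq_two_of_dvd_cyclotomic_of_dvd_cyclotomic_two_mul hp.pos hirr h₁ h₂
    rwa [natDegree_eq_orderOf_two hodd hirr h₁, even_orderOf_two_iff hp4] at heven
  · intro hp8
    obtain ⟨h, hmonic, hirr, hdvd⟩ := exists_monic_irreducible_factor (cyclotomic p (ZMod 2))
      (not_isUnit_of_natDegree_pos _ (by
        rw [natDegree_cyclotomic]; exact Nat.totient_pos.mpr hp.pos))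
    have hneg : (2 : ZMod p) ^ (p / 2) = -1 := by
      refine (ZMod.pow_div_two_eq_neg_one_or_one p ?_).resolve_left fun hone =>
        (two_pow_half_eq_one_iff hp4).mp hone hp8
      intro hzero
      have := ZMod.eq_two_of_two_eq_zero hzero
      lia
    have hk : p ∣ 2 ^ (p / 2) + 1 := by
      rw [← ZMod.natCast_eq_zero_iff]
      push_cast
      rw [hneg, neg_add_cancel]
    refine ⟨2, Nat.prime_two, h, hmonic, hirr, ?_, reverse_eq_self_of_dvd_cyclotomic hk hirr hdvd,
      hdvd, ?_⟩
    · rwa [natDegree_eq_orderOf_two hodd hirr hdvd, even_orderOf_two_iff hp4]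
    · rw [mul_comm, cyclotomic_mul_prime_eq_pow_of_not_dvd (ZMod 2) hodd.not_two_dvd_nat]
      simpa using hdvd
end

section
/- Let p and q be distinct odd prime numbers with q ≡ 3 (mod 4), and assume the Legendre symbol (p/q) equals 1. Then for all integers k, l ≥ 1 with k ≠ l and for every prime number ℓ, there is no monic irreducible polynomial h ∈ 𝔽_ℓ[X] of even degree with palindromic coefficients (h equals its reverse) dividing both the reduction of Φ_{p^k·q} modulo ℓ and the reduction of Φ_{p^l·q} modulo ℓ. -/
open Polynomial

/-- The root adjoined by a self-reciprocal irreducible polynomial over `ZMod ℓ` is conjugate to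
its inverse, hence is mapped to its inverse by a power of Frobenius. -/
theorem AdjoinRoot.exists_root_pow_mul_root_eq_one {ℓ : ℕ} [Fact ℓ.Prime] {h : (ZMod ℓ)[X]}
    [Fact (Irreducible h)] (hrev : h.reverse = h) (h0 : AdjoinRoot.root h ≠ 0) :
    ∃ n : ℕ, AdjoinRoot.root h ^ ℓ ^ n * AdjoinRoot.root h = 1 := by
  have hirr : Irreducible h := Fact.out
  have : Module.Finite (ZMod ℓ) (AdjoinRoot h) :=
    (AdjoinRoot.powerBasis hirr.ne_zero).finite
  have : Finite (AdjoinRoot h) := Module.finite_of_finite (ZMod ℓ)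
  let _ : Invertible (AdjoinRoot.root h) := invertibleOfNonzero h0
  have hroot : h.eval₂ (Algebra.ofId (ZMod ℓ) (AdjoinRoot h)) (⅟(AdjoinRoot.root h)) = 0 := by
    have key := (eval₂_reverse_eq_zero_iff (AdjoinRoot.of h) (AdjoinRoot.root h) h).2
      (AdjoinRoot.eval₂_root h)
    rwa [hrev] at key
  obtain ⟨n, hn⟩ := (FiniteField.bijective_frobeniusAlgHom_pow (ZMod ℓ) (AdjoinRoot h)).2
    (AdjoinRoot.liftAlgHom h (Algebra.ofId (ZMod ℓ) (AdjoinRoot h)) _ hroot)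
  have hfrob : ∀ (m : ℕ) (x : AdjoinRoot h),
      (FiniteField.frobeniusAlgHom (ZMod ℓ) (AdjoinRoot h) ^ m) x = x ^ ℓ ^ m := by
    intro m x
    rw [AlgHom.coe_pow, FiniteField.coe_frobeniusAlgHom, pow_iterate, ZMod.card]
  refine ⟨n, ?_⟩
  rw [← hfrob, show FiniteField.frobeniusAlgHom (ZMod ℓ) (AdjoinRoot h) ^ (n : ℕ) = _ from hn]
  simp [h0]

/-- A quadratic residue modulo a prime `q ≡ 3 [MOD 4]` has no power congruent to `-1`. -/
theorem not_dvd_pow_add_one_of_legendreSym_eq_one {p q : ℕ} [Fact q.Prime] (hq4 : q % 4 = 3)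
    (hleg : legendreSym q p = 1) (n : ℕ) : ¬ q ∣ p ^ n + 1 := by
  intro hdvd
  have hp0 : (p : ZMod q) ≠ 0 := by
    intro h0
    have : legendreSym q p = 0 := (legendreSym.eq_zero_iff q p).2 (by exact_mod_cast h0)
    omega
  have hsq := ((legendreSym.eq_one_iff' q hp0).1 hleg).pow n
  have hz : (p : ZMod q) ^ n + 1 = 0 := by
    exact_mod_cast (ZMod.natCast_eq_zero_iff _ _).2 hdvd
  rw [eq_neg_of_add_eq_zero_left hz] at hsq
  exact ZMod.exists_sq_eq_neg_one_iff.1 hsq hq4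

/-- Away from characteristic `p`, the cyclotomic polynomials of index `p ^ k * q` for distinct `k`
have no common root. -/
theorem eq_of_isRoot_cyclotomic_prime_pow_mul {K : Type*} [Field K] {p q ℓ k l : ℕ}
    [Fact ℓ.Prime] [CharP K ℓ] (hp : p.Prime) (hq : q.Prime) (hℓp : ℓ ≠ p) {x : K}
    (hk : (cyclotomic (p ^ k * q) K).IsRoot x) (hl : (cyclotomic (p ^ l * q) K).IsRoot x) :
    k = l := by
  have hℓ : ℓ.Prime := Fact.out
  have hpK : (p : K) ≠ 0 := fun h =>
    hℓp ((Nat.prime_dvd_prime_iff_eq hℓ hp).1 ((CharP.cast_eq_zero_iff K ℓ p).1 h))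
  have hppow (m : ℕ) : NeZero ((p ^ m : ℕ) : K) := ⟨by push_cast; exact pow_ne_zero m hpK⟩
  apply Nat.pow_right_injective hp.two_le
  by_cases hℓq : ℓ = q
  · subst hℓq
    rw [mul_comm, ← pow_one ℓ, isRoot_cyclotomic_prime_pow_mul_iff_of_charP] at hk hl
    exact hk.unique hl
  · have hqK : (q : K) ≠ 0 := fun h =>
      hℓq ((Nat.prime_dvd_prime_iff_eq hℓ hq).1 ((CharP.cast_eq_zero_iff K ℓ q).1 h))
    have hppowq (m : ℕ) : NeZero ((p ^ m * q : ℕ) : K) :=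
      ⟨by push_cast; exact mul_ne_zero (pow_ne_zero m hpK) hqK⟩
    rw [isRoot_cyclotomic_iff] at hk hl
    exact Nat.eq_of_mul_eq_mul_right hq.pos (hk.unique hl)

theorem stmt_16 (p q : ℕ) (hp : p.Prime) [Fact q.Prime] (hpq : p ≠ q)
    (hpodd : Odd p) (hqodd : Odd q) (hq4 : q % 4 = 3)
    (hleg : legendreSym q p = 1) :
    ∀ k l : ℕ, 1 ≤ k → 1 ≤ l → k ≠ l → ∀ ℓ : ℕ, ℓ.Prime →
      ¬ ∃ h : Polynomial (ZMod ℓ), h.Monic ∧ Irreducible h ∧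
          Even h.natDegree ∧ h.reverse = h ∧
          h ∣ (cyclotomic (p ^ k * q) ℤ).map (Int.castRingHom (ZMod ℓ)) ∧
          h ∣ (cyclotomic (p ^ l * q) ℤ).map (Int.castRingHom (ZMod ℓ)) := by
  rintro k l - - hkl ℓ hℓ ⟨h, -, hirr, -, hrev, hk, hl⟩
  have hq : q.Prime := Fact.out
  have : Fact ℓ.Prime := ⟨hℓ⟩
  have : Fact (Irreducible h) := ⟨hirr⟩
  have : CharP (AdjoinRoot h) ℓ := charP_of_injective_algebraMap (algebraMap (ZMod ℓ) _).injective ℓ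
  have hroot (n : ℕ) (hn : h ∣ (cyclotomic n ℤ).map (Int.castRingHom (ZMod ℓ))) :
      (cyclotomic n (AdjoinRoot h)).IsRoot (AdjoinRoot.root h) := by
    rw [map_cyclotomic] at hn
    rw [← map_cyclotomic n (AdjoinRoot.of h)]
    exact (AdjoinRoot.isRoot_root h).dvd (Polynomial.map_dvd _ hn)
  by_cases hℓp : ℓ = p
  · subst hℓp
    have : NeZero (q : AdjoinRoot h) := ⟨fun h0 =>
      hpq ((Nat.prime_dvd_prime_iff_eq hℓ hq).1 ((CharP.cast_eq_zero_iff _ ℓ q).1 h0))⟩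
    have hprim : IsPrimitiveRoot (AdjoinRoot.root h) q :=
      isRoot_cyclotomic_prime_pow_mul_iff_of_charP.1 (hroot _ hk)
    obtain ⟨n, hn⟩ := AdjoinRoot.exists_root_pow_mul_root_eq_one hrev (hprim.ne_zero hq.ne_zero)
    rw [← pow_succ, hprim.pow_eq_one_iff_dvd] at hn
    exact not_dvd_pow_add_one_of_legendreSym_eq_one hq4 hleg n hn
  · exact hkl (eq_of_isRoot_cyclotomic_prime_pow_mul hp hq hℓp (hroot _ hk) (hroot _ hl))
end
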